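/- arXiv:2407.07644 — 4 statements merged into one kernel-verified Lean document; each statement's English description precedes it below -/
import Mathlib

section
/- For every positive integer d, n(Z_2^d) ≤ 5d. Concretely: for every labelling of the arcs of the complete digraph on 5d vertices by elements of the group (Z_2)^d, there exists a directed cycle whose arc-labels sum to zero. -/
/-- A labelling `w` of the arcs of the complete digraph on `n` vertices by elements of an
abelian group `Γ` admits a zero-sum directed cycle: there are `ℓ + 2 ≥ 2` distinct vertices
`v 0, …, v (ℓ+1)` with `∑ i, w (v i) (v (i+1)) = 0` (indices mod `ℓ + 2`). -/
def HasZeroSumCycle {Γ : Type*} [AddCommGroup Γ] {n : ℕ} (w : Fin n → Fin n → Γ) : Prop :=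
  ∃ (ℓ : ℕ) (v : Fin (ℓ + 2) → Fin n), Function.Injective v ∧
    ∑ i : Fin (ℓ + 2), w (v i) (v (i + 1)) = 0

open Module Submodule

section IndependentTransversal

variable {K Γ E V : Type*} [Field K] [AddCommGroup Γ] [Module K Γ]

/-- The hyperedges in `I` are pairwise disjoint, avoid `X`, and their vectors form a basis
of `W`. -/
structure IsDisjointBasis (v : E → Γ) (vert : E → Finset V) (W : Submodule K Γ) (X : Finset V)
    (I : Finset E) : Prop where
  span_eq : span K (v '' I) = W
  card_le : I.card ≤ finrank K W
  pairwise : (I : Set E).PairwiseDisjoint vert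
  disjoint : ∀ e ∈ I, Disjoint (vert e) X

theorem finrank_span_image_le_card (v : E → Γ) (I : Finset E) :
    finrank K (span K (v '' I)) ≤ I.card := by
  classical
  have h := finrank_span_finset_le_card (R := K) (I.image v)
  rw [Finset.coe_image] at h
  exact h.trans Finset.card_image_le

/-- A vector in `W ⊔ span B` outside `W` can replace the vector of some element of `B`. -/
theorem exists_exchange [DecidableEq E] (v : E → Γ) (W : Submodule K Γ) (B : Finset E) {x : Γ}
    (hx : x ∈ W ⊔ span K (v '' B)) (hxW : x ∉ W) :
    ∃ j ∈ B, v j ∈ (W ⊔ span K (v '' (B.erase j : Finset E))) ⊔ span K {x} := by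
  induction B using Finset.induction_on with
  | empty => simp_all
  | insert a B ha ih =>
    by_cases hB : x ∈ W ⊔ span K (v '' B)
    · obtain ⟨j, hj, h⟩ := ih hB
      refine ⟨j, Finset.mem_insert_of_mem hj, ?_⟩
      have hle : v '' (B.erase j : Finset E) ⊆ v '' ((insert a B).erase j : Finset E) :=
        Set.image_mono (by exact_mod_cast Finset.erase_subset_erase _ (Finset.subset_insert _ _))
      have hle' := span_mono (R := K) hle
      exact (by gcongr : W ⊔ span K (v '' (B.erase j : Finset E)) ⊔ span K {x} ≤ _) h
    · refine ⟨a, Finset.mem_insert_self _ _, ?_⟩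
      rw [Finset.erase_insert ha]
      have hspan : W ⊔ span K (v '' (insert a B : Finset E)) =
          span K (insert (v a) ((W ⊔ span K (v '' B) : Submodule K Γ) : Set Γ)) := by
        rw [Finset.coe_insert, Set.image_insert_eq, span_insert, span_insert, span_eq,
          sup_left_comm]
      rw [hspan] at hx
      have h := mem_span_insert_exchange hx (by rwa [span_eq])
      rwa [span_insert, span_eq, sup_comm] at h

namespace IsDisjointBasis

variable {v : E → Γ} {vert : E → Finset V} {W : Submodule K Γ} {X : Finset V} {I : Finset E}

theorem card_eq (h : IsDisjointBasis v vert W X I) : I.card = finrank K W :=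
  h.card_le.antisymm (h.span_eq ▸ finrank_span_image_le_card v I)

theorem mem (h : IsDisjointBasis v vert W X I) {e : E} (he : e ∈ I) : v e ∈ W :=
  h.span_eq ▸ subset_span ⟨e, he, rfl⟩

theorem sdiff [FiniteDimensional K Γ] [DecidableEq E] (h : IsDisjointBasis v vert W X I)
    {B : Finset E} (hB : B ⊆ I) {Y : Finset V} (hY : ∀ e ∈ I \ B, Disjoint (vert e) Y) :
    IsDisjointBasis v vert (span K (v '' (I \ B : Finset E))) Y (I \ B) where
  span_eq := rfl
  card_le := by
    have h1 : W = span K (v '' (I \ B : Finset E)) ⊔ span K (v '' B) := by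
      rw [← h.span_eq, ← span_union, ← Set.image_union, ← Finset.coe_union,
        Finset.sdiff_union_of_subset hB]
    have h2 := finrank_add_le_finrank_add_finrank (span K (v '' (I \ B : Finset E)))
      (span K (v '' B))
    have h3 := finrank_span_image_le_card (K := K) v B
    have h4 := Finset.card_sdiff_add_card_eq_card hB
    have h5 := h.card_le
    rw [← h1] at h2
    omega
  pairwise := h.pairwise.subset (by exact_mod_cast Finset.sdiff_subset)
  disjoint := hY

/-- Recombining a disjoint basis of a smaller subspace with a further disjoint family. -/
theorem union [FiniteDimensional K Γ] [DecidableEq E] {W' : Submodule K Γ} {Y : Finset V}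
    {B : Finset E} (h : IsDisjointBasis v vert W' Y I) (hXY : X ⊆ Y)
    (hB : (B : Set E).PairwiseDisjoint vert) (hBX : ∀ e ∈ B, Disjoint (vert e) X)
    (hIB : ∀ e ∈ I, ∀ f ∈ B, Disjoint (vert e) (vert f))
    (hspan : W' ⊔ span K (v '' B) = W) (hcard : I.card + B.card ≤ finrank K W) :
    IsDisjointBasis v vert W X (I ∪ B) where
  span_eq := by
    rw [Finset.coe_union, Set.image_union, span_union, h.span_eq, hspan]
  card_le := (Finset.card_union_le _ _).trans hcard
  pairwise := by
    rw [Finset.coe_union]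
    exact h.pairwise.union hB fun e he f hf _ => hIB e he f hf
  disjoint e he := by
    rcases Finset.mem_union.1 he with he | he
    · exact (h.disjoint e he).mono_right hXY
    · exact hBX e he

variable [FiniteDimensional K Γ] [DecidableEq V] {U : Submodule K Γ}

/-- A disjoint basis of a proper subspace can be modified, without changing its span, so that
it becomes disjoint from some hyperedge whose vector lies outside that subspace. -/
theorem exists_extension (hvert : ∀ e, (vert e).card ≤ 3) (hU : ∀ e, v e ∈ U) {d : ℕ}
    (hcover : ∀ W ≤ U, ∀ X : Finset V, X.card + 5 * (finrank K W + 1) ≤ 5 * d →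
      ∃ e, Disjoint (vert e) X ∧ v e ∉ W)
    (n : ℕ) (hI : IsDisjointBasis v vert W X I) (hn : I.card = n)
    (hX : X.card + 5 * (n + 1) ≤ 5 * d) :
    ∃ I' T, IsDisjointBasis v vert W X I' ∧ Disjoint (vert T) X ∧
      (∀ e ∈ I', Disjoint (vert e) (vert T)) ∧ v T ∉ W := by
  classical
  induction n using Nat.strong_induction_on generalizing W X I with
  | _ n ih =>
  have hWU : W ≤ U := by
    rw [← hI.span_eq, span_le]
    rintro _ ⟨e, -, rfl⟩
    exact hU e
  obtain ⟨T₁, hT₁X, hT₁W⟩ := hcover W hWU X (by rw [← hI.card_eq, hn]; exact hX)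
  obtain ⟨h, hh⟩ : ∃ h, (I.filter fun e => ¬ Disjoint (vert e) (vert T₁)).card = h := ⟨_, rfl⟩
  induction h using Nat.strong_induction_on generalizing I with
  | _ h ihh =>
  set B := I.filter fun e => ¬ Disjoint (vert e) (vert T₁) with hBdef
  rcases Nat.eq_zero_or_pos h with rfl | hpos
  · refine ⟨I, T₁, hI, hT₁X, fun e he => ?_, hT₁W⟩
    by_contra hd
    have : e ∈ B := by simp [hBdef, he, hd]
    rw [Finset.card_eq_zero.1 hh] at this
    simp at this
  have hBI : B ⊆ I := Finset.filter_subset _ _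
  have hBpw : (B : Set E).PairwiseDisjoint vert := hI.pairwise.subset (by exact_mod_cast hBI)
  have hcardB := Finset.card_sdiff_add_card_eq_card hBI
  set Y := X ∪ (vert T₁ ∪ B.biUnion fun e => vert e \ vert T₁) with hY
  have hXY : X ⊆ Y := Finset.subset_union_left
  have hTY : vert T₁ ⊆ Y := Finset.subset_union_left.trans Finset.subset_union_right
  have hBY : ∀ e ∈ B, vert e ⊆ Y := by
    intro e he x hx
    by_cases hxT : x ∈ vert T₁
    · exact hTY hxT
    · simp only [hY, Finset.mem_union, Finset.mem_biUnion, Finset.mem_sdiff]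
      exact .inr (.inr ⟨e, he, hx, hxT⟩)
  have hYcard : Y.card ≤ X.card + 5 * h := by
    have h1 : (B.biUnion fun e => vert e \ vert T₁).card ≤ B.card * 2 := by
      refine Finset.card_biUnion_le_card_mul _ _ _ fun e he => ?_
      have hne : (vert e ∩ vert T₁).Nonempty :=
        Finset.not_disjoint_iff_nonempty_inter.1 (Finset.mem_filter.1 he).2
      have := Finset.card_sdiff_add_card_inter (vert e) (vert T₁)
      have := hne.card_pos
      have := hvert e
      omega
    have h2 := Finset.card_union_le X (vert T₁ ∪ B.biUnion fun e => vert e \ vert T₁)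
    have h3 := Finset.card_union_le (vert T₁) (B.biUnion fun e => vert e \ vert T₁)
    have h4 := hvert T₁
    rw [← hY] at h2
    omega
  have hI' : IsDisjointBasis v vert (span K (v '' (I \ B : Finset E))) Y (I \ B) := by
    refine hI.sdiff hBI fun e he => ?_
    obtain ⟨heI, heB⟩ := Finset.mem_sdiff.1 he
    have heT : Disjoint (vert e) (vert T₁) := by
      by_contra hd
      exact heB (by simp [hBdef, heI, hd])
    simp only [hY, Finset.disjoint_union_right, Finset.disjoint_biUnion_right]
    refine ⟨hI.disjoint e heI, heT, fun f hf => ?_⟩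
    refine (hI.pairwise heI (hBI hf) ?_).mono_right Finset.sdiff_subset
    rintro rfl
    exact heB hf
  obtain ⟨J, T, hJ, hTY', hJT, hTW⟩ := ih (I \ B).card (by omega) hI' rfl (by omega)
  have hJcard : J.card = (I \ B).card := hJ.card_eq.trans hI'.card_eq.symm
  have hW : span K (v '' (I \ B : Finset E)) ⊔ span K (v '' B) = W := by
    rw [← hI.span_eq, ← span_union, ← Set.image_union, ← Finset.coe_union,
      Finset.sdiff_union_of_subset hBI]
  have hJB : ∀ e ∈ J, ∀ f ∈ B, Disjoint (vert e) (vert f) := fun e he f hf =>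
    (hJ.disjoint e he).mono_right (hBY f hf)
  have hBX : ∀ e ∈ B, Disjoint (vert e) X := fun e he => hI.disjoint e (hBI he)
  have hTB : ∀ e ∈ B, Disjoint (vert e) (vert T) := fun e he =>
    (hTY'.mono_right (hBY e he)).symm
  have hIcard := hI.card_le
  by_cases hTW' : v T ∈ W
  · obtain ⟨j, hjB, hj⟩ := exists_exchange v _ B (hW ▸ hTW') hTW
    set C := insert T (B.erase j) with hC
    have hCcard : C.card ≤ B.card :=
      (Finset.card_insert_le _ _).trans (Finset.card_erase_add_one hjB).le
    have hCpw : (C : Set E).PairwiseDisjoint vert := by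
      rw [hC, Finset.coe_insert]
      refine (hBpw.subset (by exact_mod_cast Finset.erase_subset _ _)).insert fun e he _ => ?_
      exact (hTB e (Finset.mem_of_mem_erase he)).symm
    have hCspan : span K (v '' (I \ B : Finset E)) ⊔ span K (v '' C) = W := by
      apply le_antisymm
      · refine sup_le (hW ▸ le_sup_left) (span_le.2 ?_)
        rintro _ ⟨e, he, rfl⟩
        rcases Finset.mem_insert.1 he with rfl | he
        · exact hTW'
        · exact hI.mem (hBI (Finset.mem_of_mem_erase he))
      · have hCeq : span K (v '' C) = span K {v T} ⊔ span K (v '' (B.erase j : Finset E)) := by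
          rw [hC, Finset.coe_insert, Set.image_insert_eq, span_insert]
        have hjC : v j ∈ span K (v '' (I \ B : Finset E)) ⊔ span K (v '' C) := by
          rw [hCeq, sup_comm (span K {v T}), ← sup_assoc]
          exact hj
        rw [← hW]
        refine sup_le le_sup_left (span_le.2 ?_)
        rintro _ ⟨e, he, rfl⟩
        by_cases hej : e = j
        · exact hej ▸ hjC
        · refine mem_sup_right (subset_span ⟨e, ?_, rfl⟩)
          exact Finset.mem_insert_of_mem (Finset.mem_erase.2 ⟨hej, he⟩)
    have hI₂ : IsDisjointBasis v vert W X (J ∪ C) := by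
      refine hJ.union hXY hCpw ?_ ?_ hCspan (by omega)
      · intro e he
        rcases Finset.mem_insert.1 he with rfl | he
        · exact hTY'.mono_right hXY
        · exact hBX e (Finset.mem_of_mem_erase he)
      · intro e he f hf
        rcases Finset.mem_insert.1 hf with rfl | hf
        · exact hJT e he
        · exact hJB e he f (Finset.mem_of_mem_erase hf)
    refine ihh _ ?_ hI₂ (by rw [hI₂.card_eq, ← hI.card_eq, hn]) rfl
    rw [← hh]
    refine (Finset.card_le_card ?_).trans_lt (Finset.card_erase_lt_of_mem hjB)
    intro e he
    obtain ⟨he, hed⟩ := Finset.mem_filter.1 he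
    rcases Finset.mem_union.1 he with he | he
    · exact absurd ((hJ.disjoint e he).mono_right hTY) hed
    · rcases Finset.mem_insert.1 he with rfl | he
      · exact absurd (hTY'.mono_right hTY) hed
      · exact he
  · refine ⟨J ∪ B, T, hJ.union hXY hBpw hBX hJB hW (by omega), hTY'.mono_right hXY, ?_, hTW'⟩
    intro e he
    rcases Finset.mem_union.1 he with he | he
    · exact hJT e he
    · exact hTB e he

end IsDisjointBasis

/-- A linear-algebraic form of Haxell's theorem for 3-uniform hypergraphs: if, for each
proper subspace `W` of `U`, the hyperedges with vectors outside `W` cannot be covered by few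
vertices, then some pairwise disjoint hyperedges have vectors spanning `U`. -/
theorem exists_pairwiseDisjoint_span_eq [FiniteDimensional K Γ] [DecidableEq V]
    {U : Submodule K Γ}
    {v : E → Γ} {vert : E → Finset V} (hvert : ∀ e, (vert e).card ≤ 3) (hU : ∀ e, v e ∈ U)
    (hcover : ∀ W ≤ U, ∀ X : Finset V, X.card + 5 * (finrank K W + 1) ≤ 5 * finrank K U →
      ∃ e, Disjoint (vert e) X ∧ v e ∉ W) :
    ∃ I : Finset E, (I : Set E).PairwiseDisjoint vert ∧ span K (v '' I) = U := by
  classical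
  have key : ∀ k ≤ finrank K U, ∃ W ≤ U, ∃ I,
      IsDisjointBasis v vert W ∅ I ∧ I.card = k := by
    intro k
    induction k with
    | zero => exact fun _ => ⟨⊥, bot_le, ∅, ⟨by simp, by simp, by simp, by simp⟩, rfl⟩
    | succ k ih =>
      intro hk
      obtain ⟨W, hWU, I, hI, hIk⟩ := ih (by omega)
      obtain ⟨J, T, hJ, -, hJT, hTW⟩ :=
        hI.exists_extension hvert hU hcover k hIk (by simp; omega)
      have hJk : J.card = k := hJ.card_eq.trans (hI.card_eq.symm.trans hIk)
      have hTJ : T ∉ J := fun hT => hTW (hJ.mem hT)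
      have hlt : W < W ⊔ span K {v T} := by
        refine left_lt_sup.2 fun hle => hTW (hle (mem_span_singleton_self _))
      refine ⟨W ⊔ span K {v T}, sup_le hWU ?_, J ∪ {T}, ?_, ?_⟩
      · simpa using hU T
      · have := finrank_lt_finrank_of_lt hlt
        have := hJ.card_eq
        exact hJ.union le_rfl (by simp) (by simp) (by simpa using hJT) (by simp)
          (by simp; omega)
      · rw [Finset.card_union_of_disjoint (by simpa using hTJ), hJk, Finset.card_singleton]
  obtain ⟨W, hWU, I, hI, hIk⟩ := key _ le_rfl
  refine ⟨I, hI.pairwise, hI.span_eq.trans ?_⟩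
  exact Submodule.eq_of_le_of_finrank_le hWU (by rw [← hI.card_eq, hIk])

end IndependentTransversal

section Cycles

variable {Γ V : Type*} [AddCommGroup Γ]

/-- The sum of the labels along the walk that starts at `a` and then visits the list. -/
def walkSum (w : V → V → Γ) : V → List V → Γ
  | _, [] => 0
  | a, b :: l => w a b + walkSum w b l

/-- There is a zero-sum directed cycle all of whose vertices lie in `S`. -/
def HasZeroSumCycleIn (w : V → V → Γ) (S : Finset V) : Prop :=
  ∃ a l, (a :: l).Nodup ∧ l ≠ [] ∧ (∀ x ∈ a :: l, x ∈ S) ∧ walkSum w a (l ++ [a]) = 0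

theorem walkSum_add_sub_potential (w : V → V → Γ) (p : V → Γ) (a b : V) (l : List V) :
    walkSum (fun x y => w x y + p x - p y) a (l ++ [b]) =
      walkSum w a (l ++ [b]) + p a - p b := by
  induction l generalizing a with
  | nil => simp [walkSum]
  | cons c l ih => simp only [List.cons_append, walkSum, ih]; abel

theorem walkSum_ofFn (w : V → V → Γ) {n : ℕ} (u : Fin (n + 1) → V) (b : V) :
    walkSum w (u 0) (List.ofFn (fun i : Fin n => u i.succ) ++ [b]) =
      ∑ i : Fin n, w (u i.castSucc) (u i.succ) + w (u (Fin.last n)) b := by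
  induction n with
  | zero => simp [walkSum]
  | succ n ih =>
    rw [List.ofFn_succ, List.cons_append, walkSum, Fin.sum_univ_succ]
    exact (congrArg (w (u 0) (u 1) + ·) (ih fun i => u i.succ)).trans (add_assoc _ _ _).symm

theorem HasZeroSumCycleIn.hasZeroSumCycle {n : ℕ} {w : Fin n → Fin n → Γ}
    {S : Finset (Fin n)} (h : HasZeroSumCycleIn w S) : HasZeroSumCycle w := by
  obtain ⟨a, l, hnd, hl, -, hsum⟩ := h
  obtain ⟨m, f, rfl⟩ : ∃ (m : ℕ) (f : Fin m → Fin n), l = List.ofFn f :=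
    ⟨_, l.get, (List.ofFn_get l).symm⟩
  obtain _ | ℓ := m
  · simp at hl
  refine ⟨ℓ, Fin.cons a f, ?_, ?_⟩
  · rw [← List.nodup_ofFn, List.ofFn_cons]
    exact hnd
  · have h := walkSum_ofFn w (Fin.cons a f : Fin (ℓ + 2) → Fin n) a
    simp only [Fin.cons_succ, Fin.cons_zero] at h
    rw [hsum] at h
    rw [Fin.sum_univ_castSucc, h]
    simp [Fin.coeSucc_eq_succ]

/-- The change in the sum of a walk when the arc `(s, t)` is replaced by the path `s, m, t`. -/
def detour (w : V → V → Γ) (T : V × V × V) : Γ :=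
  w T.1 T.2.1 + w T.2.1 T.2.2 - w T.1 T.2.2

variable [Module (ZMod 2) Γ]

/-- Taking or not taking the detours in `G`, one obtains walks realising a whole coset of the
span of the corresponding changes. -/
theorem exists_sublist_walkSum (w : V → V → Γ) (G : List (V × V × V)) (a b : V) :
    ∃ c : Γ, ∀ γ ∈ span (ZMod 2) {x | ∃ T ∈ G, detour w T = x},
      ∃ l : List V, l.Sublist (G.flatMap fun T => [T.1, T.2.1, T.2.2]) ∧
        walkSum w a (l ++ [b]) = c + γ := by
  induction G generalizing a with
  | nil =>
    refine ⟨w a b, fun γ hγ => ⟨[], by simp, ?_⟩⟩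
    simp at hγ
    simp [walkSum, hγ]
  | cons T G ih =>
    obtain ⟨s, m, t⟩ := T
    obtain ⟨c, hc⟩ := ih t
    refine ⟨w a s + w s t + c, fun γ hγ => ?_⟩
    have hset : {x | ∃ T ∈ (s, m, t) :: G, detour w T = x} =
        insert (detour w (s, m, t)) {x | ∃ T ∈ G, detour w T = x} := by
      ext x
      simp [eq_comm]
    rw [hset, mem_span_insert] at hγ
    obtain ⟨ε, γ', hγ', rfl⟩ := hγ
    obtain ⟨l, hl, hsum⟩ := hc γ' hγ'
    obtain rfl | rfl := (by decide : ∀ ε : ZMod 2, ε = 0 ∨ ε = 1) ε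
    · refine ⟨s :: t :: l, ?_, ?_⟩
      · exact ((hl.cons_cons t).cons m).cons_cons s
      · simp [walkSum, hsum, add_assoc]
    · refine ⟨s :: m :: t :: l, ?_, ?_⟩
      · exact ((hl.cons_cons t).cons_cons m).cons_cons s
      · simp only [List.cons_append, walkSum, hsum, detour, one_smul]; abel

omit [Module (ZMod 2) Γ] in
theorem walkSum_mem {R : Type*} [Ring R] [Module R Γ] {w : V → V → Γ} {S : Finset V}
    {W : Submodule R Γ} (hw : ∀ x ∈ S, ∀ y ∈ S, x ≠ y → w x y ∈ W) {a b : V} {l : List V}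
    (hnd : (b :: a :: l).Nodup) (hS : ∀ x ∈ b :: a :: l, x ∈ S) :
    walkSum w a (l ++ [b]) ∈ W := by
  induction l generalizing a with
  | nil =>
    simp only [List.nodup_cons, List.mem_cons, not_or] at hnd
    simpa [walkSum] using hw a (hS a (by simp)) b (hS b (by simp)) (Ne.symm hnd.1.1)
  | cons c l ih =>
    have hac : a ≠ c := by
      rintro rfl
      simp at hnd
    refine W.add_mem (hw a (hS a (by simp)) c (hS c (by simp)) hac) (ih ?_ ?_)
    · exact hnd.sublist ((List.sublist_cons_self a (c :: l)).cons_cons b)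
    · intro x hx
      refine hS x ?_
      simp only [List.mem_cons] at hx ⊢
      tauto

/-- Disjoint detours whose changes span a subspace containing all labels give a zero-sum
cycle. -/
theorem hasZeroSumCycleIn_of_span {w : V → V → Γ} {S : Finset V} {W : Submodule (ZMod 2) Γ}
    (hw : ∀ x ∈ S, ∀ y ∈ S, x ≠ y → w x y ∈ W)
    {G : List (V × V × V)} (hG : G ≠ [])
    (hnd : (G.flatMap fun T => [T.1, T.2.1, T.2.2]).Nodup)
    (hS : ∀ x ∈ G.flatMap fun T => [T.1, T.2.1, T.2.2], x ∈ S)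
    (hspan : W ≤ span (ZMod 2) {x | ∃ T ∈ G, detour w T = x}) :
    HasZeroSumCycleIn w S := by
  obtain _ | ⟨⟨s, m, t⟩, G⟩ := G
  · exact absurd rfl hG
  obtain ⟨c, hc⟩ := exists_sublist_walkSum w G t s
  have hsub : ∀ {l : List V}, l.Sublist (G.flatMap fun T => [T.1, T.2.1, T.2.2]) →
      (s :: m :: t :: l).Nodup ∧ ∀ x ∈ s :: m :: t :: l, x ∈ S := by
    intro l hl
    have h := ((hl.cons_cons t).cons_cons m).cons_cons s
    exact ⟨hnd.sublist h, fun x hx => hS x (h.subset hx)⟩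
  have hst : ∀ {l : List V}, l.Sublist (G.flatMap fun T => [T.1, T.2.1, T.2.2]) →
      (s :: t :: l).Nodup ∧ ∀ x ∈ s :: t :: l, x ∈ S := by
    intro l hl
    have h := (List.sublist_cons_self m (t :: l)).cons_cons s
    exact ⟨(hsub hl).1.sublist h, fun x hx => (hsub hl).2 x (h.subset hx)⟩
  have htarget : -(w s t + c) ∈ W := by
    obtain ⟨l, hl, hsum⟩ := hc 0 (zero_mem _)
    obtain ⟨hnd', hS'⟩ := hst hl
    refine W.neg_mem (W.add_mem (hw s (hS' s (by simp)) t (hS' t (by simp)) ?_) ?_)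
    · rintro rfl
      simp at hnd'
    · rw [add_zero] at hsum
      exact hsum ▸ walkSum_mem hw hnd' hS'
  have hset : {x | ∃ T ∈ (s, m, t) :: G, detour w T = x} =
      insert (detour w (s, m, t)) {x | ∃ T ∈ G, detour w T = x} := by
    ext x
    simp [eq_comm]
  have hmem := hspan htarget
  rw [hset, mem_span_insert] at hmem
  obtain ⟨ε, γ, hγ, heq⟩ := hmem
  obtain ⟨l, hl, hsum⟩ := hc γ hγ
  obtain rfl | rfl := (by decide : ∀ ε : ZMod 2, ε = 0 ∨ ε = 1) ε
  · refine ⟨s, t :: l, (hst hl).1, by simp, (hst hl).2, ?_⟩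
    have hγ' : γ = -(w s t + c) := by simpa using heq.symm
    rw [List.cons_append, walkSum, hsum, hγ']
    abel
  · refine ⟨s, m :: t :: l, (hsub hl).1, by simp, (hsub hl).2, ?_⟩
    have hγ' : -(w s t + c) = detour w (s, m, t) + γ := by simpa using heq
    rw [← sub_eq_iff_eq_add'] at hγ'
    rw [List.cons_append, List.cons_append, walkSum, walkSum, hsum, ← hγ', detour]
    abel

/-- Triples of distinct vertices in `S`. -/
abbrev Triple (S : Finset V) : Type _ :=
  {T : V × V × V // [T.1, T.2.1, T.2.2].Nodup ∧ ∀ x ∈ [T.1, T.2.1, T.2.2], x ∈ S}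

theorem hasZeroSumCycleIn_of_pairwiseDisjoint [DecidableEq V] {w : V → V → Γ} {S : Finset V}
    {W : Submodule (ZMod 2) Γ} (hW : W ≠ ⊥) (hw : ∀ x ∈ S, ∀ y ∈ S, x ≠ y → w x y ∈ W)
    {I : Finset (Triple S)} (hI : (I : Set (Triple S)).PairwiseDisjoint
      fun T => [T.1.1, T.1.2.1, T.1.2.2].toFinset)
    (hspan : span (ZMod 2) ((fun T : Triple S => detour w T.1) '' I) = W) :
    HasZeroSumCycleIn w S := by
  refine hasZeroSumCycleIn_of_span (G := I.toList.map Subtype.val) hw ?_ ?_ ?_ ?_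
  · intro h
    apply hW
    have hI0 : I = ∅ := by simpa using h
    rw [← hspan, hI0]
    simp
  · rw [List.flatMap_map, List.nodup_flatMap]
    refine ⟨fun T _ => T.2.1, I.nodup_toList.pairwise_of_forall_ne fun T hT T' hT' hne => ?_⟩
    exact List.disjoint_toFinset_iff_disjoint.1
      (hI (Finset.mem_toList.1 hT) (Finset.mem_toList.1 hT') hne)
  · intro x hx
    rw [List.flatMap_map, List.mem_flatMap] at hx
    obtain ⟨T, -, hx⟩ := hx
    exact T.2.2 x hx
  · rw [← hspan]
    refine span_mono ?_
    rintro _ ⟨T, hT, rfl⟩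
    exact ⟨T.1, List.mem_map.2 ⟨T, Finset.mem_toList.2 hT, rfl⟩, rfl⟩

theorem hasZeroSumCycleIn_of_five_mul_finrank_le [DecidableEq V]
    [FiniteDimensional (ZMod 2) Γ] (w : V → V → Γ) (S : Finset V) (W : Submodule (ZMod 2) Γ)
    (hw : ∀ x ∈ S, ∀ y ∈ S, x ≠ y → w x y ∈ W) (hS : 5 * finrank (ZMod 2) W ≤ S.card)
    (hS2 : 2 ≤ S.card) : HasZeroSumCycleIn w S := by
  obtain ⟨k, hk⟩ : ∃ k, finrank (ZMod 2) W = k := ⟨_, rfl⟩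
  induction k using Nat.strong_induction_on generalizing w S W with
  | _ k ih =>
  by_cases hW : W = ⊥
  · subst hW
    obtain ⟨x, hx, y, hy, hxy⟩ := Finset.one_lt_card.1 hS2
    have h1 := hw x hx y hy hxy
    have h2 := hw y hy x hx hxy.symm
    rw [mem_bot] at h1 h2
    exact ⟨x, [y], by simpa using hxy, by simp, by simp [hx, hy], by simp [walkSum, h1, h2]⟩
  let vert : Triple S → Finset V := fun T => [T.1.1, T.1.2.1, T.1.2.2].toFinset
  let v : Triple S → Γ := fun T => detour w T.1
  by_cases hcover : ∀ W' ≤ W, ∀ X : Finset V,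
      X.card + 5 * (finrank (ZMod 2) W' + 1) ≤ 5 * finrank (ZMod 2) W →
      ∃ e, Disjoint (vert e) X ∧ v e ∉ W'
  · obtain ⟨I, hI, hspan⟩ := exists_pairwiseDisjoint_span_eq (U := W) (v := v)
      (fun T => List.toFinset_card_le _) (fun ⟨⟨s, m, t⟩, hnd, hT⟩ => by
        simp only [List.nodup_cons, List.mem_cons, List.not_mem_nil, or_false, not_or,
          forall_eq_or_imp, forall_eq] at hnd hT
        obtain ⟨hs, hm, ht⟩ := hT
        exact W.sub_mem (W.add_mem (hw s hs m hm hnd.1.1) (hw m hm t ht hnd.2.1))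
          (hw s hs t ht hnd.1.2)) hcover
    exact hasZeroSumCycleIn_of_pairwiseDisjoint hW hw hI hspan
  · push Not at hcover
    obtain ⟨W', -, X, hX, hXW'⟩ := hcover
    have hcard := Finset.le_card_sdiff X S
    obtain ⟨r, hr⟩ : (S \ X).Nonempty := Finset.card_pos.1 (by omega)
    have herase := Finset.card_erase_add_one hr
    obtain ⟨a, l, hnd, hl, hmem, hsum⟩ := ih (finrank (ZMod 2) W') (by omega)
      (fun x y => w x y + w r x - w r y) ((S \ X).erase r) W' (fun x hx y hy hxy => by
        obtain ⟨hxr, hx⟩ := Finset.mem_erase.1 hx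
        obtain ⟨hyr, hy⟩ := Finset.mem_erase.1 hy
        rw [Finset.mem_sdiff] at hr hx hy
        have h := hXW' ⟨(r, x, y), by simp [hxy, hxr.symm, hyr.symm],
          by simp [hr.1, hx.1, hy.1]⟩ (by simp [vert, hr.2, hx.2, hy.2])
        simpa [v, detour, add_comm] using h) (by omega) (by omega) rfl
    refine ⟨a, l, hnd, hl, fun x hx => ?_, ?_⟩
    · exact (Finset.mem_sdiff.1 (Finset.mem_of_mem_erase (hmem x hx))).1
    · rwa [walkSum_add_sub_potential, add_sub_cancel_right] at hsum

end Cycles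

/-- For every positive integer `d`, `n(ℤ_2^d) ≤ 5d`: every `(ℤ_2)^d`-labelling of the
complete digraph on `5d` vertices has a zero-sum directed cycle. -/
theorem zero_sum_cycle_mod_two_of_card_ge_five_d (d : ℕ) (hd : 0 < d)
    (w : Fin (5 * d) → Fin (5 * d) → (Fin d → ZMod 2)) :
    HasZeroSumCycle w := by
  refine HasZeroSumCycleIn.hasZeroSumCycle (S := Finset.univ) ?_
  exact hasZeroSumCycleIn_of_five_mul_finrank_le w _ ⊤ (by simp) (by simp) (by simp; omega)
end

section
/- There exists an absolute constant C > 0 such that for every prime p ≥ 3 and every integer d ≥ 2, n(Z_p^d) ≤ C·p·d·log d; that is, every (Z_p)^d-labelled complete digraph on ⌈C·p·d·log d⌉ vertices contains a zero-sum directed cycle. -/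
section DegreeFiltration

variable {p : ℕ} {V : Type*} [AddCommGroup V]

/-- A function `f : V → ZMod p` has degree less than `n` if all its `n`-fold differences vanish. -/
def DegLT : ℕ → (V → ZMod p) → Prop
  | 0, f => f = 0
  | n + 1, f => ∀ a, DegLT n (fwdDiff a f)

lemma degLT_zero (n : ℕ) : DegLT n (0 : V → ZMod p) := by
  induction n with
  | zero => rfl
  | succ n ih =>
    intro a
    have : fwdDiff a (0 : V → ZMod p) = 0 := by ext x; simp [fwdDiff]
    rwa [this]

lemma DegLT.add {n : ℕ} {f g : V → ZMod p} (hf : DegLT n f) (hg : DegLT n g) :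
    DegLT n (f + g) := by
  induction n generalizing f g with
  | zero => simp_all [DegLT]
  | succ n ih =>
    intro a
    rw [fwdDiff_add]
    exact ih (hf a) (hg a)

lemma DegLT.succ {n : ℕ} {f : V → ZMod p} (hf : DegLT n f) : DegLT (n + 1) f := by
  induction n generalizing f with
  | zero => rw [show f = 0 from hf]; exact degLT_zero _
  | succ n ih => exact fun a => ih (hf a)

lemma DegLT.mono {n m : ℕ} {f : V → ZMod p} (hf : DegLT n f) (h : n ≤ m) : DegLT m f := by
  induction h with
  | refl => exact hf
  | step _ ih => exact ih.succ

lemma DegLT.shift {n : ℕ} {f : V → ZMod p} (hf : DegLT n f) (a : V) :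
    DegLT n (fun x => f (x + a)) := by
  have : (fun x => f (x + a)) = f + fwdDiff a f := by ext x; simp [fwdDiff]
  rw [this]
  refine hf.add ?_
  cases n with
  | zero => rw [show f = 0 from hf]; ext x; simp [fwdDiff]
  | succ n => exact (hf a).succ

lemma DegLT.mul {m n : ℕ} {f g : V → ZMod p} (hf : DegLT (m + 1) f) (hg : DegLT (n + 1) g) :
    DegLT (m + n + 1) (f * g) := by
  induction hN : m + n generalizing m n f g with
  | zero =>
    obtain ⟨rfl, rfl⟩ : m = 0 ∧ n = 0 := by omega
    intro a
    have h1 := hf a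
    have h2 := hg a
    simp only [DegLT] at h1 h2 ⊢
    ext x
    have e1 := congrFun h1 x
    have e2 := congrFun h2 x
    simp only [fwdDiff, Pi.zero_apply, sub_eq_zero, Pi.mul_apply] at e1 e2 ⊢
    rw [e1, e2]
  | succ N ih =>
    intro a
    have hsplit : fwdDiff a (f * g) = fwdDiff a f * (fun x => g (x + a)) + f * fwdDiff a g := by
      ext x; simp [fwdDiff]; ring
    rw [hsplit]
    refine DegLT.add ?_ ?_
    · cases m with
      | zero => rw [show fwdDiff a f = 0 from hf a, zero_mul]; exact degLT_zero _
      | succ m => exact ih (hf a) (hg.shift a) (by omega)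
    · cases n with
      | zero => rw [show fwdDiff a g = 0 from hg a, mul_zero]; exact degLT_zero _
      | succ n => exact ih hf (hg a) (by omega)

lemma degLT_const (c : ZMod p) : DegLT 1 (fun _ : V => c) := by
  intro a; ext x; simp [fwdDiff]

lemma DegLT.pow {f : V → ZMod p} (hf : DegLT 2 f) (k : ℕ) : DegLT (k + 1) (f ^ k) := by
  induction k with
  | zero => rw [pow_zero]; exact degLT_const 1
  | succ k ih => rw [pow_succ]; exact ih.mul hf

lemma degLT_prod {ι : Type*} (s : Finset ι) (k : ℕ) (f : ι → V → ZMod p)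
    (hf : ∀ i ∈ s, DegLT (k + 1) (f i)) : DegLT (s.card * k + 1) (∏ i ∈ s, f i) := by
  classical
  induction s using Finset.induction_on with
  | empty =>
    rw [Finset.card_empty, zero_mul, Finset.prod_empty]
    exact degLT_const 1
  | insert i s hi ih =>
    rw [Finset.prod_insert hi, Finset.card_insert_of_notMem hi]
    refine ((hf i (by simp)).mul (ih fun j hj => hf j (by simp [hj]))).mono ?_
    linarith

lemma DegLT.iterate {n : ℕ} {f : V → ZMod p} (hf : DegLT n f) (a : V) (j : ℕ) :
    DegLT (n - j) ((fwdDiff a)^[j] f) := by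
  induction j with
  | zero => exact hf
  | succ j ih =>
    rw [Function.iterate_succ_apply']
    rcases hk : n - j with _ | k
    · rw [hk] at ih
      rw [show (fwdDiff a)^[j] f = 0 from ih]
      convert degLT_zero _
      ext x; simp [fwdDiff]
    · rw [hk] at ih
      rw [show n - (j + 1) = k by omega]
      exact ih a

lemma fwdDiff_comm (a b : V) (f : V → ZMod p) :
    fwdDiff a (fwdDiff b f) = fwdDiff b (fwdDiff a f) := by
  ext x
  simp only [fwdDiff, add_right_comm x a b]
  ring

lemma fwdDiff_iterate_comm (a b : V) (j : ℕ) (f : V → ZMod p) :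
    fwdDiff a ((fwdDiff b)^[j] f) = (fwdDiff b)^[j] (fwdDiff a f) := by
  induction j generalizing f with
  | zero => rfl
  | succ j ih => rw [Function.iterate_succ_apply, ih, fwdDiff_comm, Function.iterate_succ_apply]

variable [Fact p.Prime] [Module (ZMod p) V]

lemma fwdDiff_iterate_prime (b : V) (f : V → ZMod p) : (fwdDiff b)^[p] f = 0 := by
  have hp : p.Prime := Fact.out
  ext x
  rw [fwdDiff_iter_eq_sum_shift, Finset.sum_range_succ, Finset.sum_range_eq_add_Ico _ hp.pos,
    Finset.sum_eq_zero]
  · have : (p : ℕ) • b = 0 := by rw [← Nat.cast_smul_eq_nsmul (ZMod p)]; simp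
    simp [this, neg_one_pow_char]
  · intro k hk
    rw [Finset.mem_Ico] at hk
    have : ((p.choose k : ℕ) : ZMod p) = 0 :=
      (ZMod.natCast_eq_zero_iff _ _).2 (hp.dvd_choose_self (by omega) hk.2)
    simp [this]

/-- The directions in which the leading part (of degree `n + 1`) of `f` has zero derivative. -/
def leadingKernel (n : ℕ) (f : V → ZMod p) (hf : DegLT (n + 2) f) : Submodule (ZMod p) V where
  carrier := {a | DegLT n (fwdDiff a f)}
  zero_mem' := by
    have : fwdDiff (0 : V) f = 0 := by ext x; simp [fwdDiff]
    simpa [this] using degLT_zero n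
  add_mem' := by
    intro a b ha hb
    have : fwdDiff (a + b) f = fwdDiff a f + fwdDiff b f + fwdDiff a (fwdDiff b f) := by
      ext x
      simp only [fwdDiff, Pi.add_apply, add_assoc]
      ring
    change DegLT n (fwdDiff (a + b) f)
    rw [this]
    exact (DegLT.add ha hb).add (hf b a)
  smul_mem' := by
    intro c a ha
    have key : ∀ k : ℕ, DegLT n (fwdDiff (k • a) f) := by
      intro k
      induction k with
      | zero =>
        have : fwdDiff (0 : V) f = 0 := by ext x; simp [fwdDiff]
        simpa [this] using degLT_zero n
      | succ k ih =>
        have : fwdDiff ((k + 1) • a) f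
            = fwdDiff (k • a) f + fwdDiff a f + fwdDiff (k • a) (fwdDiff a f) := by
          ext x
          simp only [fwdDiff, Pi.add_apply, add_assoc, succ_nsmul]
          ring
        rw [this]
        exact (ih.add ha).add (hf a _)
    have := key c.val
    rwa [← Nat.cast_smul_eq_nsmul (ZMod p), ZMod.natCast_zmod_val] at this

variable [FiniteDimensional (ZMod p) V]

/-- A function of degree at most `n + 1` whose leading part is invariant under a subspace of
codimension `c` with `c * (p - 1) < n + 1` has degree at most `n`. -/
lemma degLT_of_invariant (c n : ℕ) (f : V → ZMod p) (U : Submodule (ZMod p) V)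
    (hU : Module.finrank (ZMod p) V ≤ Module.finrank (ZMod p) U + c)
    (hf : DegLT (n + 2) f) (hker : ∀ a ∈ U, DegLT n (fwdDiff a f))
    (hc : c * (p - 1) < n + 1) : DegLT (n + 1) f := by
  have hp : 2 ≤ p := (Fact.out : p.Prime).two_le
  induction c generalizing n f U with
  | zero =>
    have : U = ⊤ := Submodule.eq_top_of_finrank_eq (le_antisymm U.finrank_le hU)
    exact fun a => hker a (this ▸ Submodule.mem_top)
  | succ c ih =>
    by_cases htop : U = ⊤
    · exact fun a => hker a (htop ▸ Submodule.mem_top)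
    obtain ⟨b, -, hb⟩ := SetLike.exists_of_lt (lt_top_iff_ne_top.2 htop)
    rw [add_mul, one_mul] at hc
    have hlt : U < U ⊔ Submodule.span (ZMod p) {b} :=
      lt_of_le_of_ne le_sup_left fun h => hb (h ▸ Submodule.mem_sup_right
        (Submodule.mem_span_singleton_self b))
    have hrank := Submodule.finrank_lt_finrank_of_lt hlt
    have key : ∀ i ≤ p, DegLT (n + 1 - (p - i)) ((fwdDiff b)^[p - i] f) := by
      intro i hi
      induction i with
      | zero =>
        rw [Nat.sub_zero, fwdDiff_iterate_prime]
        exact degLT_zero _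
      | succ i ihi =>
        have hprev := ihi (by omega)
        obtain ⟨j, hj⟩ : ∃ j, p - (i + 1) = j := ⟨_, rfl⟩
        rw [show p - i = j + 1 by omega, Function.iterate_succ_apply'] at hprev
        rw [hj, show n + 1 - j = (n - j) + 1 by omega]
        have hg : DegLT (n - j + 2) ((fwdDiff b)^[j] f) :=
          (hf.iterate b j).mono (by omega)
        refine ih (n - j) _ (U ⊔ Submodule.span (ZMod p) {b}) (by omega) hg ?_ (by omega)
        change U ⊔ Submodule.span (ZMod p) {b} ≤ leadingKernel (n - j) _ hg
        refine sup_le (fun a ha => ?_) ?_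
        · change DegLT _ (fwdDiff a _)
          rw [fwdDiff_iterate_comm]
          exact (hker a ha).iterate b j
        · rw [Submodule.span_singleton_le_iff_mem]
          exact hprev.mono (by omega)
    simpa using key p le_rfl

lemma exists_degLT_support_singleton (v : V) :
    ∃ f : V → ZMod p, DegLT (Module.finrank (ZMod p) V * (p - 1) + 1) f ∧ f ≠ 0 ∧
      ∀ x, f x ≠ 0 → x = v := by
  have hp : 2 ≤ p := (Fact.out : p.Prime).two_le
  let b := Module.finBasis (ZMod p) V
  let g : Fin (Module.finrank (ZMod p) V) → V → ZMod p := fun i x => b.repr (x - v) i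
  have hlin : ∀ i, DegLT 2 (g i) := by
    intro i a c
    ext x
    simp only [fwdDiff, g, map_sub, map_add, Finsupp.sub_apply, Finsupp.add_apply, Pi.zero_apply]
    ring
  refine ⟨∏ i, (1 + (fun _ => -1) * g i ^ (p - 1)), ?_, ?_, ?_⟩
  · have := degLT_prod (p := p) (V := V) Finset.univ (p - 1)
      (fun i => 1 + (fun _ => -1) * g i ^ (p - 1)) ?_
    · simpa using this
    · intro i _
      refine ((degLT_const 1).mono (by omega)).add ?_
      simpa using (degLT_const (-1 : ZMod p)).mul ((hlin i).pow (p - 1))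
  · intro h
    have := congrFun h v
    simp [g, Finset.prod_apply, show p - 1 ≠ 0 by omega] at this
  · intro x hx
    rw [Finset.prod_apply, Finset.prod_ne_zero_iff] at hx
    rw [← sub_eq_zero, ← b.repr.map_eq_zero_iff]
    ext i
    by_contra hne
    apply hx i (Finset.mem_univ i)
    have hpow := ZMod.pow_card_sub_one_eq_one (show (b.repr (x - v)) i ≠ 0 from hne)
    simp only [Pi.add_apply, Pi.mul_apply, Pi.pow_apply, Pi.one_apply, g, hpow]
    ring

end DegreeFiltration

section AdditiveBasis

variable {p : ℕ} {V ι : Type*} [AddCommGroup V]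

/-- Wherever `g` does not vanish, some translate of the point by a subset sum of `a` over `T` is
a point where `f` does not vanish. -/
def Detects (a : ι → V) (T : Finset ι) (f g : V → ZMod p) : Prop :=
  ∀ x, g x ≠ 0 → ∃ S ⊆ T, f (x + ∑ i ∈ S, a i) ≠ 0

lemma Detects.refl (a : ι → V) (f : V → ZMod p) : Detects a ∅ f f :=
  fun x hx => ⟨∅, subset_rfl, by simpa using hx⟩

variable [DecidableEq ι]

lemma Detects.trans {a : ι → V} {T T' : Finset ι} {f g h : V → ZMod p} (hT : Disjoint T T')
    (hfg : Detects a T f g) (hgh : Detects a T' g h) : Detects a (T ∪ T') f h := by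
  intro x hx
  obtain ⟨S', hS', hx'⟩ := hgh x hx
  obtain ⟨S, hS, hx''⟩ := hfg _ hx'
  refine ⟨S ∪ S', Finset.union_subset_union hS hS', ?_⟩
  rw [Finset.sum_union (Finset.disjoint_of_subset_left hS (Finset.disjoint_of_subset_right hS' hT)),
    add_comm (∑ i ∈ S, a i), ← add_assoc]
  exact hx''

lemma Detects.fwdDiff {a : ι → V} {T : Finset ι} {f g : V → ZMod p} {j : ι} (hj : j ∉ T)
    (hfg : Detects a T f g) : Detects a (insert j T) f (fwdDiff (a j) g) := by
  have hstep : Detects a {j} g (_root_.fwdDiff (a j) g) := by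
    intro x hx
    by_cases h : g x = 0
    · refine ⟨{j}, subset_rfl, ?_⟩
      simpa [_root_.fwdDiff, h] using hx
    · exact ⟨∅, by simp, by simpa using h⟩
  rw [Finset.insert_eq, Finset.union_comm]
  exact hfg.trans (by simpa using hj) hstep

variable [Fact p.Prime] [Module (ZMod p) V] [FiniteDimensional (ZMod p) V]

lemma exists_detects_of_span_eq_top (a : ι → V) (J : Finset ι)
    (hJ : Submodule.span (ZMod p) (a '' J) = ⊤) (D : ℕ) (f : V → ZMod p)
    (hf : DegLT (D + 1) f) (hf' : ¬ DegLT D f) :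
    ∃ T ⊆ J, ∃ (g : V → ZMod p) (D' : ℕ), Detects a T f g ∧ DegLT (D' + 1) g ∧ ¬ DegLT D' g ∧
      p * D' ≤ (p - 1) * D := by
  have hp : 2 ≤ p := (Fact.out : p.Prime).two_le
  suffices H : ∀ (D' : ℕ) (T : Finset ι) (g : V → ZMod p), T ⊆ J → Detects a T f g →
      DegLT (D' + 1) g → ¬ DegLT D' g → T.card + D' = D →
      ∃ T ⊆ J, ∃ (g : V → ZMod p) (D' : ℕ), Detects a T f g ∧ DegLT (D' + 1) g ∧ ¬ DegLT D' g ∧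
        p * D' ≤ (p - 1) * D from
    H D ∅ f (by simp) (Detects.refl a f) hf hf' (by simp)
  intro D'
  obtain ⟨q, rfl⟩ : ∃ q, p = q + 1 := ⟨p - 1, by omega⟩
  classical
  induction D' with
  | zero => exact fun T g hTJ hdet hg hg' _ => ⟨T, hTJ, g, 0, hdet, hg, hg', by simp⟩
  | succ n ih =>
    intro T g hTJ hdet hg hg' hcard
    by_cases hnext : ∀ j ∈ J \ T, DegLT n (fwdDiff (a j) g)
    · refine ⟨T, hTJ, g, n + 1, hdet, hg, hg', ?_⟩
      by_contra! hlt
      rw [Nat.add_sub_cancel, ← hcard] at hlt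
      apply hg'
      refine degLT_of_invariant T.card n g (leadingKernel n g hg) ?_ hg (fun _ h => h) ?_
      · have hle : (⊤ : Submodule (ZMod (q + 1)) V) ≤
            leadingKernel n g hg ⊔ Submodule.span (ZMod (q + 1)) (T.image a : Set V) := by
          rw [← hJ, Submodule.span_le]
          rintro _ ⟨j, hj, rfl⟩
          by_cases hjT : j ∈ T
          · exact Submodule.mem_sup_right (Submodule.subset_span
              (by simpa using ⟨j, hjT, rfl⟩))
          · exact Submodule.mem_sup_left (hnext j (by simp [hjT, show j ∈ J from hj]))
        have h1 := Submodule.finrank_mono hle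
        rw [finrank_top] at h1
        have h2 := Submodule.finrank_add_le_finrank_add_finrank (leadingKernel n g hg)
          (Submodule.span (ZMod (q + 1)) (T.image a : Set V))
        have h3 := (finrank_span_finset_le_card (R := ZMod (q + 1)) (T.image a)).trans
          Finset.card_image_le
        unfold Set.finrank at h3
        omega
      · rw [Nat.add_sub_cancel]
        nlinarith
    · push Not at hnext
      obtain ⟨j, hj, hjn⟩ := hnext
      rw [Finset.mem_sdiff] at hj
      refine ih (insert j T) (fwdDiff (a j) g) (Finset.insert_subset hj.1 hTJ)
        (hdet.fwdDiff hj.2) (hg _) hjn ?_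
      rw [Finset.card_insert_of_notMem hj.2]
      omega

/-- Sufficiently many disjoint spanning families together form an additive basis. -/
theorem exists_subset_sum_eq {d k : ℕ} (hd : Module.finrank (ZMod p) V ≤ d)
    (hk : d * (p - 1) ^ k ≤ p ^ k) (a : ι → V) (J : ℕ → Finset ι)
    (hdisj : Pairwise fun i j => Disjoint (J i) (J j))
    (hJ : ∀ i < k + p, Submodule.span (ZMod p) (a '' J i) = ⊤) (v : V) :
    ∃ S ⊆ (Finset.range (k + p)).biUnion J, ∑ i ∈ S, a i = v := by
  have hp : 2 ≤ p := (Fact.out : p.Prime).two_le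
  obtain ⟨f, hf, hf0, hfv⟩ := exists_degLT_support_singleton (p := p) v
  obtain ⟨D₀, hD₀, hD₀', hD₀d⟩ : ∃ D₀, DegLT (D₀ + 1) f ∧ ¬ DegLT D₀ f ∧ D₀ ≤ d * (p - 1) := by
    classical
    have hex : ∃ n, DegLT n f := ⟨_, hf⟩
    have hpos : Nat.find hex ≠ 0 := fun h => hf0 (by simpa [h, DegLT] using Nat.find_spec hex)
    refine ⟨Nat.find hex - 1, ?_, Nat.find_min hex (by omega), ?_⟩
    · rw [Nat.sub_add_cancel (by omega)]
      exact Nat.find_spec hex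
    · have := (Nat.find_min' hex hf).trans
        (Nat.add_le_add_right (Nat.mul_le_mul_right (p - 1) hd) 1)
      omega
  have hone : ∀ n D, p ^ n * D ≤ (p - 1) ^ (n + 1) * d → n = k → D ≤ p - 1 := by
    rintro n D h rfl
    refine Nat.le_of_mul_le_mul_left (h.trans ?_) (pow_pos (by omega) n : 0 < p ^ n)
    calc (p - 1) ^ (n + 1) * d = (p - 1) * (d * (p - 1) ^ n) := by ring
      _ ≤ (p - 1) * p ^ n := Nat.mul_le_mul_left _ hk
      _ = p ^ n * (p - 1) := mul_comm _ _
  have hiter : ∀ n ≤ k + p, ∃ (g : V → ZMod p) (D : ℕ),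
      Detects a ((Finset.range n).biUnion J) f g ∧ DegLT (D + 1) g ∧ ¬ DegLT D g ∧
      p ^ n * D ≤ (p - 1) ^ (n + 1) * d ∧ (k ≤ n → D ≤ (p - 1) - (n - k)) := by
    intro n hn
    induction n with
    | zero =>
      have hbound : p ^ 0 * D₀ ≤ (p - 1) ^ (0 + 1) * d := by
        rw [pow_zero, one_mul, zero_add, pow_one, mul_comm]
        exact hD₀d
      refine ⟨f, D₀, by simpa using Detects.refl a f, hD₀, hD₀', hbound, fun hk0 => ?_⟩
      simpa using hone 0 D₀ hbound (by omega)
    | succ n ih =>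
      obtain ⟨g, D, hdet, hg, hg', hbound, hsmall⟩ := ih (by omega)
      obtain ⟨T, hT, g', D', hdet', hgT, hgT', hD'⟩ :=
        exists_detects_of_span_eq_top a (J n) (hJ n (by omega)) D g hg hg'
      have hbound' : p ^ (n + 1) * D' ≤ (p - 1) ^ (n + 1 + 1) * d := calc
        p ^ (n + 1) * D' = p ^ n * (p * D') := by ring
        _ ≤ p ^ n * ((p - 1) * D) := Nat.mul_le_mul_left _ hD'
        _ = (p - 1) * (p ^ n * D) := by ring
        _ ≤ (p - 1) * ((p - 1) ^ (n + 1) * d) := Nat.mul_le_mul_left _ hbound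
        _ = (p - 1) ^ (n + 1 + 1) * d := by ring
      refine ⟨g', D', ?_, hgT, hgT', hbound', fun hkn => ?_⟩
      · have hdisjT : Disjoint ((Finset.range n).biUnion J) T := by
          rw [Finset.disjoint_biUnion_left]
          intro i hi
          exact Finset.disjoint_of_subset_right hT (hdisj (Finset.mem_range.1 hi).ne)
        intro x hx
        obtain ⟨S, hS, hSx⟩ := hdet.trans hdisjT hdet' x hx
        refine ⟨S, hS.trans ?_, hSx⟩
        rw [Finset.range_add_one, Finset.biUnion_insert, Finset.union_comm]
        exact Finset.union_subset_union hT subset_rfl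
      · rcases hkn.eq_or_lt with h | h
        · simpa [h] using hone (n + 1) D' hbound' h.symm
        · have h1 := hsmall (by omega)
          obtain ⟨q, rfl⟩ : ∃ q, p = q + 1 := ⟨p - 1, by omega⟩
          rw [Nat.add_sub_cancel] at *
          have h2 : D' ≤ D - 1 := by
            rcases D with _ | D
            · nlinarith
            · rw [Nat.add_sub_cancel]
              by_contra! hlt
              nlinarith
          omega
  obtain ⟨g, D, hdet, hg, hg', -, hsmall⟩ := hiter (k + p) le_rfl
  obtain rfl : D = 0 := by have := hsmall (by omega); omega
  obtain ⟨x, hx⟩ : ∃ x, g x ≠ 0 := by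
    by_contra! h
    exact hg' (funext h)
  have hg0 : g 0 ≠ 0 := by
    have := congrFun (show fwdDiff x g = 0 from hg x) 0
    simp only [fwdDiff, zero_add, Pi.zero_apply, sub_eq_zero] at this
    rwa [← this]
  obtain ⟨S, hS, hSx⟩ := hdet 0 hg0
  exact ⟨S, hS, by simpa using hfv _ hSx⟩

end AdditiveBasis

section IndependentMatching

variable {K V α β : Type*} [Field K] [AddCommGroup V] [Module K V] [DecidableEq α]

lemma exists_notMem_span_diff_singleton {vec : α → V} {M : Set α} (hM : LinearIndepOn K vec M)
    {A : Set α} (hA : A ⊆ M) (B : Finset α) (hB : (B : Set α) ⊆ A) {x : V}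
    (hx : x ∈ Submodule.span K (vec '' A)) (hx' : x ∉ Submodule.span K (vec '' (A \ B))) :
    ∃ e ∈ B, x ∉ Submodule.span K (vec '' (M \ {e})) := by
  by_contra! h
  apply hx'
  have key : ∀ C ⊆ B, x ∈ Submodule.span K (vec '' (A \ C)) := by
    intro C
    induction C using Finset.induction_on with
    | empty => simpa using hx
    | insert e C he ih =>
      intro hC
      have heB : e ∈ B := hC (by simp)
      have hprev := ih ((Finset.subset_insert e C).trans hC)
      by_contra hnot
      have hsub : A \ C ⊆ insert e (A \ (insert e C : Finset α)) := by
        intro y hy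
        by_cases hye : y = e
        · exact Or.inl hye
        · exact Or.inr ⟨hy.1, by simpa [hye] using hy.2⟩
      have h1 : x ∈ Submodule.span K (insert (vec e) (vec '' (A \ (insert e C : Finset α)))) := by
        rw [← Set.image_insert_eq]
        exact Submodule.span_mono (Set.image_mono hsub) hprev
      have h2 := mem_span_insert_exchange h1 hnot
      have h3 : vec e ∈ Submodule.span K (vec '' (M \ {e})) := by
        refine Submodule.span_le.2 (Set.insert_subset (h e heB) ?_) h2
        refine (Set.image_mono ?_).trans Submodule.subset_span
        intro y hy
        refine ⟨hA hy.1, fun hye => hy.2 ?_⟩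
        simp [show y = e from hye]
      exact (linearIndepOn_iff_notMem_span.1 hM e (hA (hB heB))) h3
  exact key B subset_rfl

/-- A set of pairwise disjoint hyperedges (with supports `supp`) whose vectors are independent. -/
structure IsIndependentMatching (K : Type*) {V α β : Type*} [Field K] [AddCommGroup V] [Module K V]
    (supp : α → Finset β) (vec : α → V) (M : Finset α) : Prop where
  disjoint : ∀ e ∈ M, ∀ f ∈ M, e ≠ f → Disjoint (supp e) (supp f)
  indep : LinearIndepOn K vec (M : Set α)

variable {supp : α → Finset β} {vec : α → V}

lemma IsIndependentMatching.insert {M : Finset α} {f : α}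
    (hM : IsIndependentMatching K supp vec M) (hf : ∀ e ∈ M, Disjoint (supp e) (supp f))
    (hspan : vec f ∉ Submodule.span K (vec '' (M : Set α))) :
    IsIndependentMatching K supp vec (insert f M) where
  disjoint := by
    intro a ha b hb hab
    rcases Finset.mem_insert.1 ha with rfl | ha' <;> rcases Finset.mem_insert.1 hb with rfl | hb'
    · exact absurd rfl hab
    · exact (hf b hb').symm
    · exact hf a ha'
    · exact hM.disjoint a ha' b hb' hab
  indep := by
    rw [Finset.coe_insert]
    exact hM.indep.insert hspan

lemma IsIndependentMatching.erase {M : Finset α} (hM : IsIndependentMatching K supp vec M) (e : α) :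
    IsIndependentMatching K supp vec (M.erase e) where
  disjoint a ha b hb := hM.disjoint a (Finset.mem_of_mem_erase ha) b (Finset.mem_of_mem_erase hb)
  indep := hM.indep.mono (Finset.coe_subset.2 (Finset.erase_subset e M))

variable [DecidableEq β]

/-- The members of `M` that meet `f`. -/
def blockers {α β : Type*} [DecidableEq β] (supp : α → Finset β) (M : Finset α) (f : α) :
    Finset α :=
  {e ∈ M | ¬ Disjoint (supp e) (supp f)}

/-- The members of `M` that meet some entry of the list. -/
def allBlockers {α β : Type*} [DecidableEq α] [DecidableEq β] (supp : α → Finset β) (M : Finset α) :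
    List α → Finset α
  | [] => ∅
  | f :: L => blockers supp M f ∪ allBlockers supp M L

/-- The list (latest entry first) is an exchange chain for `M`: every entry avoids the earlier
entries and their blockers, and is independent from what remains of `M` once these blockers are
deleted. -/
def IsExchangeChain (K : Type*) {V α β : Type*} [Field K] [AddCommGroup V] [Module K V]
    [DecidableEq α] [DecidableEq β] (supp : α → Finset β) (vec : α → V) (M : Finset α) :
    List α → Prop
  | [] => True
  | f :: L => IsExchangeChain K supp vec M L ∧ (∀ g ∈ L, Disjoint (supp f) (supp g)) ∧
      (∀ e ∈ allBlockers supp M L, Disjoint (supp e) (supp f)) ∧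
      vec f ∉ Submodule.span K (vec '' ((M \ allBlockers supp M L : Finset α) : Set α))

/-- Either `M` can be enlarged, or it can be replaced by an independent matching of the same size
for which an initial part of the chain stays a chain, with the same blockers except that its latest
entry has fewer of them. -/
def Improvable (K : Type*) {V α β : Type*} [Field K] [AddCommGroup V] [Module K V]
    [DecidableEq α] [DecidableEq β] (supp : α → Finset β) (vec : α → V) (M : Finset α) :
    List α → Prop
  | [] => ∃ M', IsIndependentMatching K supp vec M' ∧ M'.card = M.card + 1
  | f :: L => Improvable K supp vec M L ∨ ∃ M', IsIndependentMatching K supp vec M' ∧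
      M'.card = M.card ∧ IsExchangeChain K supp vec M' (f :: L) ∧
      (∀ g ∈ L, blockers supp M' g = blockers supp M g) ∧
      (blockers supp M' f).card < (blockers supp M f).card

lemma allBlockers_subset (M : Finset α) (L : List α) : allBlockers supp M L ⊆ M := by
  induction L with
  | nil => simp [allBlockers]
  | cons f L ih => exact Finset.union_subset (Finset.filter_subset _ _) ih

lemma blockers_subset_allBlockers {M : Finset α} {L : List α} {f : α} (hf : f ∈ L) :
    blockers supp M f ⊆ allBlockers supp M L := by
  induction L with
  | nil => simp at hf
  | cons g L ih =>
    rcases List.mem_cons.1 hf with rfl | h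
    · exact Finset.subset_union_left
    · exact (ih h).trans Finset.subset_union_right

lemma allBlockers_congr {M M' : Finset α} {L : List α}
    (h : ∀ g ∈ L, blockers supp M' g = blockers supp M g) :
    allBlockers supp M' L = allBlockers supp M L := by
  induction L with
  | nil => rfl
  | cons g L ih =>
    rw [allBlockers, allBlockers, h g (by simp), ih fun x hx => h x (by simp [hx])]

lemma Improvable.congr {M M' : Finset α} {L : List α} (hcard : M'.card = M.card)
    (h : ∀ g ∈ L, blockers supp M' g = blockers supp M g) (hM' : Improvable K supp vec M' L) :
    Improvable K supp vec M L := by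
  induction L with
  | nil =>
    obtain ⟨N, hN, hNc⟩ := hM'
    exact ⟨N, hN, hNc.trans (by rw [hcard])⟩
  | cons f L ih =>
    rcases hM' with hM' | ⟨N, hN, hNc, hch, hb, hlt⟩
    · exact Or.inl (ih (fun g hg => h g (by simp [hg])) hM')
    · exact Or.inr ⟨N, hN, hNc.trans hcard, hch,
        fun g hg => (hb g hg).trans (h g (by simp [hg])), by rwa [h f (by simp)] at hlt⟩

lemma blockers_swap {M : Finset α} {e f g : α} (hfg : Disjoint (supp f) (supp g)) :
    blockers supp (insert f (M.erase e)) g = (blockers supp M g).erase e := by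
  rw [blockers, Finset.filter_insert, if_neg (not_not.2 hfg), Finset.filter_erase]
  rfl

lemma IsExchangeChain.swap {M : Finset α} {L : List α} {e f g : α}
    (hch : IsExchangeChain K supp vec M (g :: L)) (he : e ∉ allBlockers supp M L)
    (hf : ∀ h ∈ L, Disjoint (supp f) (supp h))
    (hspan : vec f ∈ Submodule.span K (vec '' ((M \ allBlockers supp M L : Finset α) : Set α))) :
    IsExchangeChain K supp vec (insert f (M.erase e)) (g :: L) := by
  induction L generalizing g with
  | nil =>
    refine ⟨trivial, by simp, by simp [allBlockers], fun hmem => hch.2.2.2 ?_⟩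
    refine Submodule.span_le.2 ?_ hmem
    rintro _ ⟨y, hy, rfl⟩
    simp only [allBlockers, Finset.sdiff_empty, Finset.coe_insert, Set.mem_insert_iff,
      Finset.mem_coe, Finset.mem_erase] at hy hspan ⊢
    rcases hy with rfl | hy
    · exact hspan
    · exact Submodule.subset_span ⟨y, hy.2, rfl⟩
  | cons h L ih =>
    have hsame : allBlockers supp (insert f (M.erase e)) (h :: L) = allBlockers supp M (h :: L) :=
      allBlockers_congr fun x hx => by
        rw [blockers_swap (hf x hx), Finset.erase_eq_of_notMem]
        exact fun hex => he (blockers_subset_allBlockers hx hex)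
    refine ⟨ih hch.1 (fun h' => he (Finset.mem_union_right _ h')) (fun x hx => hf x (by simp [hx]))
      (Submodule.span_mono (Set.image_mono ?_) hspan), hch.2.1, by rw [hsame]; exact hch.2.2.1, ?_⟩
    · exact Finset.coe_subset.2 (Finset.sdiff_subset_sdiff subset_rfl Finset.subset_union_right)
    · rw [hsame]
      refine fun hmem => hch.2.2.2 (Submodule.span_le.2 ?_ hmem)
      rintro _ ⟨y, hy, rfl⟩
      rw [Finset.mem_coe, Finset.mem_sdiff, Finset.mem_insert, Finset.mem_erase] at hy
      rcases hy with ⟨rfl | hy, hy'⟩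
      · exact hspan
      · exact Submodule.subset_span ⟨y, by simp [hy.2, hy'], rfl⟩

/-- An unblocked hyperedge that extends an exchange chain leads to an improvement. -/
lemma improvable_of_unblocked (hne : ∀ e, (supp e).Nonempty) {M : Finset α} {L : List α} {f : α}
    (hM : IsIndependentMatching K supp vec M) (hch : IsExchangeChain K supp vec M (f :: L))
    (hf : blockers supp M f = ∅) : Improvable K supp vec M L := by
  have hdisj : ∀ e ∈ M, Disjoint (supp e) (supp f) := by
    simpa [blockers, Finset.filter_eq_empty_iff] using hf
  have hfM : f ∉ M := fun h => (hne f).ne_empty (disjoint_self.1 (hdisj f h))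
  induction L with
  | nil =>
    refine ⟨insert f M, hM.insert hdisj ?_, Finset.card_insert_of_notMem hfM⟩
    simpa [allBlockers] using hch.2.2.2
  | cons g L ih =>
    obtain ⟨hchg, hfL, hfB, hspan⟩ := hch
    by_cases hin : vec f ∈ Submodule.span K (vec '' ((M \ allBlockers supp M L : Finset α) : Set α))
    · have hBA : blockers supp M g ⊆ M \ allBlockers supp M L := by
        intro e he
        rw [blockers, Finset.mem_filter] at he
        exact Finset.mem_sdiff.2 ⟨he.1, fun h => he.2 (hchg.2.2.1 e h)⟩
      obtain ⟨e, he, hespan⟩ := exists_notMem_span_diff_singleton hM.indep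
        (Finset.coe_subset.2 Finset.sdiff_subset) (blockers supp M g) (Finset.coe_subset.2 hBA) hin
        (by
          rw [← Finset.coe_sdiff]
          convert hspan using 5
          ext x
          simp only [allBlockers, Finset.mem_sdiff, Finset.mem_union]
          tauto)
      have heM : e ∈ M := (Finset.mem_filter.1 he).1
      have heL : e ∉ allBlockers supp M L := (Finset.mem_sdiff.1 (hBA he)).2
      have hfL' : ∀ x ∈ L, Disjoint (supp f) (supp x) := fun x hx => hfL x (by simp [hx])
      refine Or.inr ⟨insert f (M.erase e), (hM.erase e).insert
        (fun x hx => hdisj x (Finset.mem_of_mem_erase hx)) (by rwa [Finset.coe_erase]), ?_,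
        hchg.swap heL hfL' hin, fun x hx => ?_, ?_⟩
      · rw [Finset.card_insert_of_notMem fun h => hfM (Finset.mem_of_mem_erase h),
          Finset.card_erase_add_one heM]
      · rw [blockers_swap (hfL' x hx), Finset.erase_eq_of_notMem]
        exact fun h => heL (blockers_subset_allBlockers hx h)
      · rw [blockers_swap (hfL g (by simp))]
        exact Finset.card_erase_lt_of_mem he
    · exact Or.inl (ih ⟨hchg.1, fun x hx => hfL x (by simp [hx]),
        fun x hx => hfB x (Finset.mem_union_right _ hx), hin⟩)

lemma length_le_card_allBlockers {M : Finset α} {L : List α}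
    (hch : IsExchangeChain K supp vec M L) (hL : ∀ f ∈ L, (blockers supp M f).Nonempty) :
    L.length ≤ (allBlockers supp M L).card := by
  induction L with
  | nil => simp
  | cons f L ih =>
    have hdis : Disjoint (blockers supp M f) (allBlockers supp M L) := by
      rw [Finset.disjoint_left]
      intro e he he'
      exact (Finset.mem_filter.1 he).2 (hch.2.2.1 e he')
    have h1 := ih hch.1 fun x hx => hL x (by simp [hx])
    have h2 := (hL f (by simp)).card_pos
    rw [allBlockers, Finset.card_union_of_disjoint hdis, List.length_cons]
    omega

lemma improvable_of_cover {r : ℕ} (hne : ∀ e, (supp e).Nonempty) (hr : ∀ e, (supp e).card ≤ r)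
    (hcov : ∀ (W : Submodule K V) (X : Finset β),
      X.card + 2 * r * (Module.finrank K W + 1) ≤ 2 * r * Module.finrank K V →
      ∃ f, Disjoint (supp f) X ∧ vec f ∉ W)
    {M : Finset α} {L : List α} (hM : IsIndependentMatching K supp vec M)
    (hcard : M.card < Module.finrank K V) (hch : IsExchangeChain K supp vec M L)
    (hL : ∀ f ∈ L, (blockers supp M f).Nonempty) : Improvable K supp vec M L := by
  induction hs : M.card - (allBlockers supp M L).card using Nat.strong_induction_on
    generalizing M L with
  | _ s ihs =>
    obtain ⟨f, hfX, hfspan⟩ := hcov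
      (Submodule.span K (vec '' ((M \ allBlockers supp M L : Finset α) : Set α)))
      (L.toFinset.biUnion supp ∪ (allBlockers supp M L).biUnion supp) (by
        have h1 := Finset.card_union_le (L.toFinset.biUnion supp)
          ((allBlockers supp M L).biUnion supp)
        have h2 := Finset.card_biUnion_le_card_mul L.toFinset supp r fun e _ => hr e
        have h3 := Finset.card_biUnion_le_card_mul (allBlockers supp M L) supp r fun e _ => hr e
        have h4 := (List.toFinset_card_le L).trans (length_le_card_allBlockers hch hL)
        have h5 := Finset.card_sdiff_add_card_eq_card (allBlockers_subset (supp := supp) M L)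
        have h6 : Module.finrank K (Submodule.span K
            (vec '' ((M \ allBlockers supp M L : Finset α) : Set α))) ≤
            (M \ allBlockers supp M L).card := by
          classical
          rw [← Finset.coe_image]
          exact (finrank_span_finset_le_card _).trans Finset.card_image_le
        have h7 := Nat.mul_le_mul_right r h4
        have h8 : 2 * r * ((allBlockers supp M L).card + (Module.finrank K (Submodule.span K
            (vec '' ((M \ allBlockers supp M L : Finset α) : Set α))) + 1)) ≤
            2 * r * Module.finrank K V := Nat.mul_le_mul_left _ (by omega)
        nlinarith)
    rw [Finset.disjoint_union_right, Finset.disjoint_biUnion_right,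
      Finset.disjoint_biUnion_right] at hfX
    have hchf : IsExchangeChain K supp vec M (f :: L) :=
      ⟨hch, fun g hg => hfX.1 g (by simpa using hg), fun e he => (hfX.2 e he).symm, hfspan⟩
    suffices H : ∀ (b : ℕ) (M' : Finset α), IsIndependentMatching K supp vec M' →
        M'.card = M.card → IsExchangeChain K supp vec M' (f :: L) →
        (∀ g ∈ L, blockers supp M' g = blockers supp M g) → (blockers supp M' f).card = b →
        Improvable K supp vec M' L from
      H _ M hM rfl hchf (fun _ _ => rfl) rfl
    intro b
    induction b using Nat.strong_induction_on with
    | _ b ihb =>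
      intro M' hM' hM'c hch' hsame hb
      rcases (blockers supp M' f).eq_empty_or_nonempty with hemp | hnon
      · exact improvable_of_unblocked hne hM' hch' hemp
      have hall := allBlockers_congr hsame
      have hlt : (allBlockers supp M' L).card < (allBlockers supp M' (f :: L)).card := by
        refine Finset.card_lt_card (Finset.ssubset_iff_subset_ne.2
          ⟨Finset.subset_union_right, fun heq => ?_⟩)
        obtain ⟨e, he⟩ := hnon
        have : e ∈ allBlockers supp M' L := by
          rw [heq]
          exact Finset.mem_union_left _ he
        exact (Finset.mem_filter.1 he).2 (hch'.2.2.1 e this)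
      have hle := Finset.card_le_card (allBlockers_subset (supp := supp) M' (f :: L))
      have himp : Improvable K supp vec M' (f :: L) := by
        refine ihs _ ?_ hM' (by omega) hch' ?_ rfl
        · rw [hall] at hlt
          omega
        · intro g hg
          rcases List.mem_cons.1 hg with rfl | hg
          · exact hnon
          · rw [hsame g hg]
            exact hL g hg
      rcases himp with himp | ⟨N, hN, hNc, hNch, hNsame, hNlt⟩
      · exact himp
      · exact (ihb _ (by omega) N hN (hNc.trans hM'c) hNch
          (fun g hg => (hNsame g hg).trans (hsame g hg)) rfl).congr hNc hNsame

/-- A Rado-type theorem for hypergraphs of rank at most `r`: if the hyperedges outside any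
subspace `W` cannot be covered by few vertices, in terms of the codimension of `W`, then some
pairwise disjoint hyperedges carry a basis. -/
theorem exists_isIndependentMatching_card_eq {r : ℕ} (hne : ∀ e, (supp e).Nonempty)
    (hr : ∀ e, (supp e).card ≤ r)
    (hcov : ∀ (W : Submodule K V) (X : Finset β),
      X.card + 2 * r * (Module.finrank K W + 1) ≤ 2 * r * Module.finrank K V →
      ∃ f, Disjoint (supp f) X ∧ vec f ∉ W) :
    ∃ M, IsIndependentMatching K supp vec M ∧ M.card = Module.finrank K V := by
  suffices H : ∀ k ≤ Module.finrank K V, ∃ M, IsIndependentMatching K supp vec M ∧ M.card = k from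
    H _ le_rfl
  intro k hk
  induction k with
  | zero => exact ⟨∅, ⟨by simp, by simp⟩, rfl⟩
  | succ k ih =>
    obtain ⟨M, hM, hMk⟩ := ih (by omega)
    obtain ⟨M', hM', hc⟩ := improvable_of_cover (L := []) hne hr hcov hM (by omega)
      trivial (by simp)
    exact ⟨M', hM', hc.trans (by rw [hMk])⟩

end IndependentMatching

section Cycles

variable {α β Γ : Type*} [AddCommGroup Γ]

/-- The total weight of the walk that starts at `x` and then visits the entries of a list. -/
def walkWeight (w : β → β → Γ) : β → List β → Γ
  | _, [] => 0
  | x, y :: l => w x y + walkWeight w y l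

lemma walkWeight_eq_sum (w : β → β → Γ) (x c : β) (l : List β) :
    walkWeight w x l =
      ∑ k ∈ Finset.range l.length, w ((x :: l).getD k c) ((x :: l).getD (k + 1) c) := by
  induction l generalizing x with
  | nil => simp [walkWeight]
  | cons y l ih =>
    rw [walkWeight, ih, List.length_cons, Finset.sum_range_succ']
    simp only [List.getD_cons_succ, List.getD_cons_zero]
    rw [add_comm]

lemma hasZeroSumCycle_of_walkWeight_eq_zero {n : ℕ} {w : Fin n → Fin n → Γ} {x : Fin n}
    {l : List (Fin n)} (hl : l ≠ []) (hnodup : (x :: l).Nodup)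
    (hw : walkWeight w x (l ++ [x]) = 0) : HasZeroSumCycle w := by
  obtain ⟨ℓ, hℓ⟩ : ∃ ℓ, l.length = ℓ + 1 := Nat.exists_eq_succ_of_ne_zero (by simpa using hl)
  have hget : ∀ k, (x :: (l ++ [x])).getD k x = (x :: l).getD k x := by
    intro k
    rw [← List.cons_append]
    rcases lt_or_ge k (x :: l).length with h | h
    · rw [List.getD_append _ _ _ _ h]
    · rw [List.getD_append_right _ _ _ _ h, List.getD_eq_default _ _ h]
      cases k - (x :: l).length <;> simp
  refine ⟨ℓ, fun i => (x :: l).getD i x, fun i j hij => ?_, ?_⟩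
  · have hi : (i : ℕ) < (x :: l).length := by have := i.isLt; simp [hℓ]; omega
    have hj : (j : ℕ) < (x :: l).length := by have := j.isLt; simp [hℓ]; omega
    simp only [List.getD_eq_getElem _ _ hi, List.getD_eq_getElem _ _ hj] at hij
    exact Fin.ext ((List.Nodup.getElem_inj_iff hnodup).1 hij)
  · rw [walkWeight_eq_sum w x x, List.length_append, hℓ, List.length_singleton,
      ← Fin.sum_univ_eq_sum_range (fun k => w ((x :: (l ++ [x])).getD k x)
        ((x :: (l ++ [x])).getD (k + 1) x))] at hw
    rw [← hw]
    refine Finset.sum_congr rfl fun i _ => ?_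
    beta_reduce
    rw [hget, hget, Fin.val_add_one]
    split_ifs with hi
    · rw [hi, List.getD_eq_default (x :: l) (n := (Fin.last (ℓ + 1) : ℕ) + 1) x (by simp [hℓ]),
        List.getD_cons_zero]
    · rfl

/-- The change of weight when the arc `(x, y)` is replaced by the path `x, z, y`, for a triple
`(x, z, y)`. -/
def detourWeight (w : β → β → Γ) (t : β × β × β) : Γ :=
  w t.1 t.2.1 + w t.2.1 t.2.2 - w t.1 t.2.2

variable [DecidableEq α]

/-- The vertices visited when traversing the triples of a list one by one, making the detours
belonging to the indices in `S`. -/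
def route (t : α → β × β × β) (S : Finset α) (l : List α) : List β :=
  l.flatMap fun e => if e ∈ S then [(t e).1, (t e).2.1, (t e).2.2] else [(t e).1, (t e).2.2]

lemma walkWeight_route (w : β → β → Γ) (t : α → β × β × β) (S : Finset α) (l : List α)
    (x : β) (l' : List β) :
    walkWeight w x (route t S l ++ l') = walkWeight w x (route t ∅ l ++ l') +
      (l.map fun e => if e ∈ S then detourWeight w (t e) else 0).sum := by
  induction l generalizing x with
  | nil => simp [route]
  | cons e l ih =>
    have hcons : ∀ T : Finset α, route t T (e :: l) =
        (if e ∈ T then [(t e).1, (t e).2.1, (t e).2.2] else [(t e).1, (t e).2.2]) ++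
          route t T l := fun T => List.flatMap_cons
    rw [hcons, hcons, if_neg (Finset.notMem_empty e)]
    split_ifs with h <;>
      simp only [List.cons_append, List.nil_append, walkWeight, ih, List.map_cons, List.sum_cons,
        h, if_true, if_false, detourWeight] <;> abel

/-- The vertices of a triple. -/
def tripleSupport [DecidableEq β] (t : β × β × β) : Finset β := {t.1, t.2.1, t.2.2}

lemma mem_tripleSupport_of_mem_route [DecidableEq β] {t : α → β × β × β} {S : Finset α}
    {l : List α} {x : β} (hx : x ∈ route t S l) : ∃ e ∈ l, x ∈ tripleSupport (t e) := by
  obtain ⟨e, he, hxe⟩ := List.mem_flatMap.1 hx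
  refine ⟨e, he, ?_⟩
  split_ifs at hxe <;> simp [tripleSupport] at hxe ⊢ <;> tauto

lemma nodup_route [DecidableEq β] {t : α → β × β × β} {S : Finset α} {l : List α} (hl : l.Nodup)
    (ht : ∀ e ∈ l, (t e).1 ≠ (t e).2.1 ∧ (t e).2.1 ≠ (t e).2.2 ∧ (t e).1 ≠ (t e).2.2)
    (hdisj : ∀ e ∈ l, ∀ f ∈ l, e ≠ f → Disjoint (tripleSupport (t e)) (tripleSupport (t f))) :
    (route t S l).Nodup := by
  refine List.nodup_flatMap.2 ⟨fun e he => ?_, ?_⟩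
  · obtain ⟨h1, h2, h3⟩ := ht e he
    split_ifs <;> simp [h1, h2, h3]
  · refine (List.Pairwise.imp_of_mem ?_ hl)
    intro e f he hf hef
    rw [Function.onFun, List.disjoint_left]
    intro x hx hx'
    refine Finset.disjoint_left.1 (hdisj e he f hf hef) (?_ : x ∈ _) ?_
    · split_ifs at hx <;> simp [tripleSupport] at hx ⊢ <;> tauto
    · split_ifs at hx' <;> simp [tripleSupport] at hx' ⊢ <;> tauto

/-- All detours through three distinct vertices of `A` have weight in `U`. -/
def DetoursIn {R : Type*} [Ring R] [Module R Γ] (w : β → β → Γ) (A : Finset β)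
    (U : Submodule R Γ) : Prop :=
  ∀ x ∈ A, ∀ z ∈ A, ∀ y ∈ A, x ≠ z → z ≠ y → x ≠ y → detourWeight w (x, z, y) ∈ U

variable {R : Type*} [Ring R] [Module R Γ] {w : β → β → Γ} {A : Finset β} {U : Submodule R Γ}

lemma DetoursIn.exists_potential (hA : 3 ≤ A.card) (hw : ∀ x, w x x = 0) (h : DetoursIn w A U) :
    ∃ φ : β → Γ, ∀ x ∈ A, ∀ y ∈ A, w x y - (φ y - φ x) ∈ U := by
  classical
  obtain ⟨o, ho⟩ := Finset.card_pos.1 (show 0 < A.card by omega)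
  refine ⟨w o, fun x hx y hy => ?_⟩
  by_cases hxy : x = y
  · simp [hxy, hw]
  by_cases hox : o = x
  · simp [← hox, hw]
  by_cases hoy : o = y
  · subst hoy
    obtain ⟨z, hz⟩ : ((A.erase o).erase x).Nonempty := by
      rw [← Finset.card_pos, Finset.card_erase_of_mem (by simp [hx, Ne.symm hox]),
        Finset.card_erase_of_mem ho]
      omega
    simp only [Finset.mem_erase] at hz
    have h1 := h x hx o ho z hz.2.2 hxy (Ne.symm hz.2.1) (Ne.symm hz.1)
    have h2 := h o ho x hx z hz.2.2 hox (Ne.symm hz.1) (Ne.symm hz.2.1)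
    convert U.add_mem h1 h2 using 1
    simp only [detourWeight, hw]
    abel
  · convert h o ho x hx y hy hox hxy hoy using 1
    simp only [detourWeight]
    abel

lemma walkWeight_sub_potential_mem {φ : β → Γ}
    (hφ : ∀ x ∈ A, ∀ y ∈ A, w x y - (φ y - φ x) ∈ U) {x y : β} (hx : x ∈ A) (hy : y ∈ A)
    {l : List β} (hl : ∀ z ∈ l, z ∈ A) : walkWeight w x (l ++ [y]) - (φ y - φ x) ∈ U := by
  induction l generalizing x with
  | nil => simpa [walkWeight] using hφ x hx y hy
  | cons z l ih =>
    convert U.add_mem (hφ x hx z (hl z (by simp)))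
      (ih (hl z (by simp)) fun a ha => hl a (by simp [ha]))
      using 1
    simp only [List.cons_append, walkWeight]
    abel

end Cycles

section CopiesOfASpace

variable {K U ι : Type*} [Field K] [AddCommGroup U] [Module K U] [FiniteDimensional K U]
  [Fintype ι] [DecidableEq ι]

lemma card_mul_finrank_iInf_comap_single_le (W : Submodule K (ι → U)) :
    Fintype.card ι * Module.finrank K (⨅ j, W.comap (LinearMap.single K (fun _ : ι => U) j) :
      Submodule K U) ≤ Module.finrank K W := by
  set W₀ : Submodule K U := ⨅ j, W.comap (LinearMap.single K (fun _ : ι => U) j) with hW₀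
  have hle : LinearMap.range (W₀.subtype.compLeft ι) ≤ W := by
    rintro _ ⟨g, rfl⟩
    rw [← Finset.univ_sum_single (W₀.subtype.compLeft ι g)]
    exact W.sum_mem fun j _ => Submodule.mem_iInf _ |>.1 (g j).2 j
  have hinj : Function.Injective (W₀.subtype.compLeft ι) := fun f g hfg =>
    funext fun j => Subtype.ext (congrFun hfg j)
  refine le_trans (le_of_eq ?_) (Submodule.finrank_mono hle)
  rw [LinearMap.finrank_range_of_inj hinj, Module.finrank_pi_fintype]
  simp

lemma span_image_filter_eq_top_of_linearIndepOn_single {γ : Type*} {a : γ → U}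
    {M : Finset (γ × ι)}
    (hM : LinearIndepOn K (fun e : γ × ι => Pi.single (M := fun _ => U) e.2 (a e.1)) M)
    (hcard : M.card = Fintype.card ι * Module.finrank K U) (i : ι) :
    Submodule.span K ((fun e : γ × ι => a e.1) '' (M.filter fun e => e.2 = i : Finset (γ × ι))) =
      ⊤ := by
  have htop : Submodule.span K
      ((fun e : γ × ι => Pi.single (M := fun _ => U) e.2 (a e.1)) '' M) = ⊤ := by
    have := LinearIndependent.span_eq_top_of_card_eq_finrank' (b := fun e : (M : Set (γ × ι)) =>
      (Pi.single (M := fun _ => U) e.1.2 (a e.1.1) : ι → U)) hM (by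
        rw [Module.finrank_pi_fintype]
        simp [hcard])
    rwa [Set.image_eq_range]
  rw [eq_top_iff]
  intro u _
  have hu : LinearMap.proj (R := K) (φ := fun _ : ι => U) i (Pi.single i u) ∈
      (⊤ : Submodule K (ι → U)).map (LinearMap.proj i) :=
    Submodule.mem_map_of_mem Submodule.mem_top
  rw [← htop, Submodule.map_span, LinearMap.proj_apply, Pi.single_eq_same] at hu
  refine Submodule.span_le.2 ?_ hu
  rintro _ ⟨_, ⟨e, he, rfl⟩, rfl⟩
  by_cases hei : e.2 = i
  · refine Submodule.subset_span ⟨e, by simpa [hei] using he, ?_⟩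
    simp [← hei]
  · simp [Pi.single_eq_of_ne (Ne.symm hei)]

end CopiesOfASpace

section Main

variable {p : ℕ} [Fact p.Prime] {V : Type*} [AddCommGroup V] [Module (ZMod p) V]
  {n : ℕ} {w : Fin n → Fin n → V} {A : Finset (Fin n)}
  {U : Submodule (ZMod p) V} {k d : ℕ}

lemma hasZeroSumCycle_of_detoursIn_bot (hw : ∀ x, w x x = 0) (hA : 3 ≤ A.card)
    (hU : DetoursIn w A (⊥ : Submodule (ZMod p) V)) : HasZeroSumCycle w := by
  obtain ⟨φ, hφ⟩ := hU.exists_potential hA hw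
  obtain ⟨x, hx, y, hy, hxy⟩ := Finset.one_lt_card.1 (show 1 < A.card by omega)
  refine hasZeroSumCycle_of_walkWeight_eq_zero (x := x) (l := [y]) (by simp) (by simpa using hxy) ?_
  have := walkWeight_sub_potential_mem hφ hx hx (l := [y]) (by simpa using hy)
  simpa using this

variable [FiniteDimensional (ZMod p) V]

/-- The three entries of a triple are distinct vertices of `A`. -/
def IsTripleIn {β : Type*} (A : Finset β) (t : β × β × β) : Prop :=
  (t.1 ∈ A ∧ t.2.1 ∈ A ∧ t.2.2 ∈ A) ∧ t.1 ≠ t.2.1 ∧ t.2.1 ≠ t.2.2 ∧ t.1 ≠ t.2.2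

lemma hasZeroSumCycle_of_spanning_triples {α : Type*} [DecidableEq α] (hw : ∀ x, w x x = 0)
    (hA : 3 ≤ A.card) (hU : DetoursIn w A U) (hd : Module.finrank (ZMod p) U ≤ d)
    (hk : d * (p - 1) ^ k ≤ p ^ k) {t : α → Fin n × Fin n × Fin n} (ht : ∀ e, IsTripleIn A (t e))
    {a : α → U} (ha : ∀ e, (a e : V) = detourWeight w (t e)) {M : Finset α} (hM : M.Nonempty)
    (hdisj : ∀ e ∈ M, ∀ f ∈ M, e ≠ f → Disjoint (tripleSupport (t e)) (tripleSupport (t f)))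
    (J : ℕ → Finset α) (hJM : ∀ i, J i ⊆ M) (hJ : Pairwise fun i j => Disjoint (J i) (J j))
    (hspan : ∀ i < k + p, Submodule.span (ZMod p) (a '' J i) = ⊤) : HasZeroSumCycle w := by
  obtain ⟨φ, hφ⟩ := hU.exists_potential hA hw
  obtain ⟨g, gs, hgs⟩ : ∃ g gs, M.toList = g :: gs :=
    List.exists_cons_of_ne_nil (by simpa using hM.ne_empty)
  set x := (t g).1 with hx
  have hxA : x ∈ A := (ht g).1.1
  have hroute : ∀ S : Finset α, ∃ l, l ≠ [] ∧ route t S M.toList = x :: l := by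
    intro S
    rw [hgs, route, List.flatMap_cons]
    split_ifs
    · exact ⟨_, by simp, rfl⟩
    · exact ⟨_, by simp, rfl⟩
  have hnodup : ∀ S : Finset α, (route t S M.toList).Nodup := fun S =>
    nodup_route M.nodup_toList (fun e _ => (ht e).2) fun e he f hf =>
      hdisj e (by simpa using he) f (by simpa using hf)
  have hbase : walkWeight w x (route t ∅ M.toList ++ [x]) ∈ U := by
    have := walkWeight_sub_potential_mem hφ hxA hxA (l := route t ∅ M.toList) fun z hz => by
      obtain ⟨e, -, he⟩ := mem_tripleSupport_of_mem_route hz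
      obtain ⟨⟨h1, h2, h3⟩, -⟩ := ht e
      simp only [tripleSupport, Finset.mem_insert, Finset.mem_singleton] at he
      rcases he with rfl | rfl | rfl <;> assumption
    simpa using this
  obtain ⟨S, hS, hsum⟩ := exists_subset_sum_eq hd hk a J hJ hspan (-⟨_, hbase⟩)
  have hSM : S ⊆ M := hS.trans (Finset.biUnion_subset.2 fun i _ => hJM i)
  obtain ⟨l, hl, hxl⟩ := hroute S
  refine hasZeroSumCycle_of_walkWeight_eq_zero hl (hxl ▸ hnodup S) ?_
  have hstart : walkWeight w x (route t S M.toList ++ [x]) = walkWeight w x (l ++ [x]) := by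
    rw [hxl, List.cons_append, walkWeight, hw, zero_add]
  rw [← hstart, walkWeight_route, Finset.sum_map_toList, ← Finset.sum_filter,
    Finset.filter_mem_eq_inter, Finset.inter_eq_right.2 hSM]
  have := congrArg (Subtype.val) hsum
  simp only [Submodule.coe_sum, ha, Submodule.coe_neg] at this
  rw [this, add_neg_cancel]

lemma hasZeroSumCycle_of_forall_card (hw : ∀ x, w x x = 0) (hA : 3 ≤ A.card)
    (hU : DetoursIn w A U) (hpos : 0 < Module.finrank (ZMod p) U)
    (hd : Module.finrank (ZMod p) U ≤ d) (hk : d * (p - 1) ^ k ≤ p ^ k)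
    (hno : ∀ W < U, ∀ X : Finset (Fin n), DetoursIn w (A \ X) W →
      6 * (k + p) * (Module.finrank (ZMod p) U - Module.finrank (ZMod p) W) < X.card) :
    HasZeroSumCycle w := by
  classical
  let a : {t // IsTripleIn A t} → U := fun t => ⟨detourWeight w t.1, hU _ t.2.1.1 _ t.2.1.2.1 _
    t.2.1.2.2 t.2.2.1 t.2.2.2.1 t.2.2.2.2⟩
  have hfin : Module.finrank (ZMod p) (Fin (k + p) → U) = (k + p) * Module.finrank (ZMod p) U := by
    rw [Module.finrank_pi_fintype]
    simp
  obtain ⟨M, hM, hcard⟩ := exists_isIndependentMatching_card_eq (K := ZMod p)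
    (supp := fun e : {t // IsTripleIn A t} × Fin (k + p) => tripleSupport e.1.1)
    (vec := fun e => Pi.single (M := fun _ => U) e.2 (a e.1)) (r := 3)
    (fun e => by simp [tripleSupport]) (fun e => Finset.card_le_three) (by
      intro W X hX
      by_contra! hcon
      set W₀ : Submodule (ZMod p) U :=
        ⨅ j, W.comap (LinearMap.single (ZMod p) (fun _ : Fin (k + p) => U) j) with hW₀
      have hfinW := card_mul_finrank_iInf_comap_single_le W
      rw [← hW₀, Fintype.card_fin] at hfinW
      have hmap : Module.finrank (ZMod p) (W₀.map U.subtype) = Module.finrank (ZMod p) W₀ :=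
        Submodule.finrank_map_subtype_eq U W₀
      have hlt : W₀.map U.subtype < U := by
        refine lt_of_le_of_ne (U.map_subtype_le W₀) fun h => ?_
        rw [h] at hmap
        rw [← hmap] at hfinW
        rw [hfin] at hX
        omega
      have hdet : DetoursIn w (A \ X) (W₀.map U.subtype) := by
        intro x hx z hz y hy hxz hzy hxy
        rw [Finset.mem_sdiff] at hx hz hy
        let g : {t // IsTripleIn A t} := ⟨(x, z, y), ⟨hx.1, hz.1, hy.1⟩, hxz, hzy, hxy⟩
        refine ⟨a g, (Submodule.mem_iInf _).2 fun j => hcon (g, j) ?_, rfl⟩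
        simp [g, tripleSupport, hx.2, hz.2, hy.2]
      have h1 := hno _ hlt X hdet
      rw [hmap, Nat.mul_sub, mul_assoc, mul_assoc] at h1
      rw [hfin] at hX
      omega)
  rw [hfin] at hcard
  have hp : 0 < p := (Fact.out : p.Prime).pos
  have hspan := span_image_filter_eq_top_of_linearIndepOn_single (a := a) hM.indep
    (by rw [hcard, Fintype.card_fin])
  refine hasZeroSumCycle_of_spanning_triples hw hA hU hd hk
    (t := fun e : {t // IsTripleIn A t} × Fin (k + p) => e.1.1) (fun e => e.1.2)
    (a := fun e => a e.1) (fun e => rfl) (M := M) ?_ hM.disjoint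
    (fun i => M.filter fun e => (e.2 : ℕ) = i) (fun i => Finset.filter_subset _ _) ?_ ?_
  · rw [← Finset.card_pos, hcard]
    positivity
  · intro i j hij
    refine Finset.disjoint_filter.2 fun e _ h1 h2 => hij (h1.symm.trans h2)
  · intro i hi
    rw [← hspan ⟨i, hi⟩]
    simp only [Fin.ext_iff]

lemma hasZeroSumCycle_of_detoursIn (hw : ∀ x, w x x = 0) (hk : d * (p - 1) ^ k ≤ p ^ k)
    (hU : DetoursIn w A U) (hd : Module.finrank (ZMod p) U ≤ d)
    (hA : 6 * (k + p) * Module.finrank (ZMod p) U + 3 ≤ A.card) : HasZeroSumCycle w := by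
  induction hs : Module.finrank (ZMod p) U using Nat.strong_induction_on generalizing A U with
  | _ s ih =>
  subst hs
  rcases Nat.eq_zero_or_pos (Module.finrank (ZMod p) U) with h0 | hpos
  · rw [Submodule.finrank_eq_zero] at h0
    subst h0
    exact hasZeroSumCycle_of_detoursIn_bot hw (by omega) hU
  by_cases hex : ∃ W < U, ∃ X : Finset (Fin n), DetoursIn w (A \ X) W ∧
      X.card ≤ 6 * (k + p) * (Module.finrank (ZMod p) U - Module.finrank (ZMod p) W)
  · obtain ⟨W, hWU, X, hW, hX⟩ := hex
    have hlt := Submodule.finrank_lt_finrank_of_lt hWU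
    refine ih _ hlt hW (by omega) ?_ rfl
    have := Finset.le_card_sdiff X A
    rw [Nat.mul_sub] at hX
    have := Nat.mul_le_mul_left (6 * (k + p)) hlt.le
    omega
  · push Not at hex
    exact hasZeroSumCycle_of_forall_card hw (by omega) hU hpos hd hk hex

end Main

lemma mul_pred_pow_le_pow {p d : ℕ} (hp : 1 ≤ p) (hd : 1 ≤ d) :
    d * (p - 1) ^ ⌈p * Real.log d⌉₊ ≤ p ^ ⌈p * Real.log d⌉₊ := by
  set k := ⌈p * Real.log d⌉₊ with hk
  have hp' : (0 : ℝ) < p := by exact_mod_cast hp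
  have hd' : (0 : ℝ) < d := by exact_mod_cast hd
  have h1 : (1 - 1 / (p : ℝ)) ^ k ≤ 1 / d := by
    have hle : 1 - 1 / (p : ℝ) ≤ Real.exp (-(1 / p)) := by
      linarith [Real.add_one_le_exp (-(1 / (p : ℝ)))]
    have hnn : 0 ≤ 1 - 1 / (p : ℝ) := by
      rw [sub_nonneg, div_le_one hp']
      exact_mod_cast hp
    calc (1 - 1 / (p : ℝ)) ^ k ≤ Real.exp (-(1 / p)) ^ k := pow_le_pow_left₀ hnn hle k
      _ = Real.exp (-(k / p)) := by rw [← Real.exp_nat_mul]; ring_nf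
      _ ≤ Real.exp (-Real.log d) := by
        rw [Real.exp_le_exp, neg_le_neg_iff, le_div_iff₀ hp', mul_comm]
        exact Nat.le_ceil _
      _ = 1 / d := by rw [Real.exp_neg, Real.exp_log hd', one_div]
  have h2 : (d : ℝ) * ((p : ℝ) - 1) ^ k ≤ p ^ k := by
    have h3 : ((p : ℝ) - 1) ^ k = p ^ k * (1 - 1 / (p : ℝ)) ^ k := by
      rw [← mul_pow]
      field_simp
    rw [h3]
    calc (d : ℝ) * (p ^ k * (1 - 1 / (p : ℝ)) ^ k) ≤ d * (p ^ k * (1 / d)) := by gcongr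
      _ = p ^ k := by field_simp
  rw [← Nat.cast_le (α := ℝ)]
  push_cast [Nat.cast_sub hp]
  exact h2

lemma hasZeroSumCycle_congr {Γ : Type*} [AddCommGroup Γ] {n : ℕ} {w w' : Fin n → Fin n → Γ}
    (h : ∀ x y, x ≠ y → w x y = w' x y) (hw : HasZeroSumCycle w) : HasZeroSumCycle w' := by
  obtain ⟨ℓ, v, hv, hsum⟩ := hw
  refine ⟨ℓ, v, hv, hsum ▸ Finset.sum_congr rfl fun i _ => (h _ _ fun hi => ?_).symm⟩
  simpa using hv hi

/-- There is an absolute constant `C > 0` such that for every prime `p ≥ 3` and every `d ≥ 2`,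
`n(ℤ_p^d) ≤ C·p·d·log d`: every `(ℤ_p)^d`-labelling of the complete digraph on
`⌈C·p·d·log d⌉` vertices has a zero-sum directed cycle. -/
theorem zero_sum_cycle_of_card_ge_pd_log_d :
    ∃ C : ℝ, 0 < C ∧ ∀ p d : ℕ, p.Prime → 3 ≤ p → 2 ≤ d →
      ∀ w : Fin ⌈C * p * d * Real.log d⌉₊ → Fin ⌈C * p * d * Real.log d⌉₊ →
        (Fin d → ZMod p), HasZeroSumCycle w := by
  refine ⟨100, by norm_num, fun p d hp hp3 hd w => ?_⟩
  have : Fact p.Prime := ⟨hp⟩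
  have hk := mul_pred_pow_le_pow (p := p) (d := d) (by omega) (by omega)
  set k := ⌈p * Real.log d⌉₊ with hkdef
  refine hasZeroSumCycle_congr (w := fun x y => if x = y then 0 else w x y)
    (fun x y hxy => if_neg hxy) ?_
  refine hasZeroSumCycle_of_detoursIn (p := p) (A := Finset.univ) (U := ⊤) (k := k) (d := d)
    (fun x => if_pos rfl) hk (fun _ _ _ _ _ _ _ _ _ => Submodule.mem_top) (by simp) ?_
  rw [finrank_top, Module.finrank_fin_fun, Finset.card_univ, Fintype.card_fin,
    ← Nat.cast_le (α := ℝ)]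
  refine le_trans ?_ (Nat.le_ceil _)
  push_cast
  have hp3' : (3 : ℝ) ≤ p := by exact_mod_cast hp3
  have hd' : (2 : ℝ) ≤ d := by exact_mod_cast hd
  have hlog : 0.69 ≤ Real.log d :=
    le_trans (by linarith [Real.log_two_gt_d9]) (Real.log_le_log (by norm_num) hd')
  have hpd : 6 ≤ (p : ℝ) * d := by nlinarith
  have hklt : (k : ℝ) < p * Real.log d + 1 := Nat.ceil_lt_add_one (by positivity)
  have h1 : (k : ℝ) * d ≤ (p * Real.log d + 1) * d := by gcongr
  have h2 : 0.69 * (p * d) ≤ Real.log d * (p * d) := by gcongr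
  nlinarith
end

section
/- Let r ≥ 1 and let H be a (multi-)hypergraph in which every hyperedge has size at most r, let M be a matroid, and let γ: E(H) → E(M) be a hyperedge-labelling. If (H,γ) contains a maximal independent matching of size ℓ ≥ 0, then there exist an integer a with 0 ≤ a ≤ ℓ and a vertex set U ⊆ V(H) with |U| ≤ (2r−1)a such that H − U contains an independent matching of size ℓ − a whose set of labels forms a basis of span(γ(E(H−U))). -/
/-- Given a (multi-)hypergraph with vertex type `V` and hyperedges indexed by `ι` via
`E : ι → Finset V`, a matroid `M` and a hyperedge-labelling `γ : ι → α`, a finset `N` of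
hyperedges is an *independent matching* of the subhypergraph with available hyperedge set
`A` if its hyperedges lie in `A`, are pairwise vertex-disjoint, have pairwise distinct
labels, and their set of labels is independent in `M`. -/
def IsIndepMatching {V ι α : Type*} (E : ι → Finset V) (M : Matroid α) (γ : ι → α)
    (A : Set ι) (N : Finset ι) : Prop :=
  ↑N ⊆ A ∧
  (∀ e ∈ N, ∀ f ∈ N, e ≠ f → Disjoint (E e) (E f)) ∧
  Set.InjOn γ ↑N ∧
  M.Indep (γ '' ↑N)

/-- An independent matching `N` (with available hyperedge set `A`) is *maximal* if there is
no independent matching `N'` with `span (γ(N')) = span (γ(N))` such that `N'` is not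
inclusion-wise maximal. -/
def IsMaximalIndepMatching {V ι α : Type*} (E : ι → Finset V) (M : Matroid α) (γ : ι → α)
    (A : Set ι) (N : Finset ι) : Prop :=
  IsIndepMatching E M γ A N ∧
  ∀ N' : Finset ι, IsIndepMatching E M γ A N' →
    M.closure (γ '' ↑N') = M.closure (γ '' ↑N) →
    ∀ N'' : Finset ι, IsIndepMatching E M γ A N'' → ¬ N' ⊂ N''

/-- A finite set `N ⊆ A` of pairwise vertex-disjoint hyperedges, independent in a matroid on
the hyperedges. -/
def IsMatroidMatching {V ι : Type*} (E : ι → Finset V) (M : Matroid ι) (A : Set ι)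
    (N : Finset ι) : Prop :=
  ↑N ⊆ A ∧ (∀ e ∈ N, ∀ f ∈ N, e ≠ f → Disjoint (E e) (E f)) ∧ M.Indep ↑N

/-- A matroid matching such that no matroid matching with the same span can be extended. -/
def IsMaximalMatroidMatching {V ι : Type*} (E : ι → Finset V) (M : Matroid ι) (A : Set ι)
    (N : Finset ι) : Prop :=
  IsMatroidMatching E M A N ∧
  ∀ N' : Finset ι, IsMatroidMatching E M A N' → M.closure ↑N' = M.closure ↑N →
    ∀ g ∈ A, g ∉ M.closure ↑N' → ∃ f ∈ N', ¬ Disjoint (E f) (E g)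

theorem isIndepMatching_iff_comap {V ι α : Type*} {E : ι → Finset V} {M : Matroid α}
    {γ : ι → α} {A : Set ι} {N : Finset ι} :
    IsIndepMatching E M γ A N ↔ IsMatroidMatching E (M.comap γ) A N := by
  simp only [IsIndepMatching, IsMatroidMatching, Matroid.comap_indep_iff]
  tauto

theorem Matroid.comap_closure_eq_closure_iff {ι α : Type*} (M : Matroid α) {γ : ι → α}
    (hγ : ∀ e, γ e ∈ M.E) (X Y : Set ι) :
    (M.comap γ).closure X = (M.comap γ).closure Y ↔
      M.closure (γ '' X) = M.closure (γ '' Y) := by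
  have key : ∀ X Y : Set ι, (M.comap γ).closure X = (M.comap γ).closure Y →
      M.closure (γ '' X) ⊆ M.closure (γ '' Y) := by
    intro X Y h
    refine M.closure_subset_closure_of_subset_closure ?_
    rintro _ ⟨x, hx, rfl⟩
    have hx' : x ∈ (M.comap γ).closure X :=
      (M.comap γ).mem_closure_of_mem' hx (hγ x)
    rwa [h, Matroid.comap_closure_eq] at hx'
  refine ⟨fun h ↦ (key X Y h).antisymm (key Y X h.symm), fun h ↦ ?_⟩
  simp only [Matroid.comap_closure_eq, h]

/-- A finite set of vertex-disjoint hyperedges containing a matroid matching `N` contains a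
matroid matching that extends `N` and has full span. -/
theorem IsMatroidMatching.exists_extension {V ι : Type*} {E : ι → Finset V} {M : Matroid ι}
    (hM : M.E = Set.univ) {A B : Set ι} {N X : Finset ι} (hN : IsMatroidMatching E M B N)
    (hNX : N ⊆ X) (hXA : ↑X ⊆ A)
    (hX : ∀ e ∈ X, ∀ f ∈ X, e ≠ f → Disjoint (E e) (E f)) :
    ∃ J : Finset ι, N ⊆ J ∧ J ⊆ X ∧ IsMatroidMatching E M A J ∧
      M.closure ↑J = M.closure ↑X := by
  obtain ⟨J, hJ, hNJ⟩ := hN.2.2.subset_isBasis_of_subset (Finset.coe_subset.2 hNX)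
    (by simp [hM])
  lift J to Finset ι using X.finite_toSet.subset hJ.subset
  have hJX : J ⊆ X := Finset.coe_subset.1 hJ.subset
  exact ⟨J, Finset.coe_subset.1 hNJ, hJX, ⟨hJ.subset.trans hXA,
    fun e he f hf ↦ hX e (hJX he) f (hJX hf), hJ.indep⟩, hJ.closure_eq_closure⟩

/-- Deleting a hyperedge `e` outside the span of a maximal matroid matching `N`, together with
the set `F` of members of `N` meeting it, leaves a maximal matroid matching, provided that no
matching with the same span has fewer members meeting a hyperedge outside the span. -/
theorem IsMaximalMatroidMatching.delete {V ι : Type*} [DecidableEq V] [DecidableEq ι]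
    {E : ι → Finset V} {M : Matroid ι} (hM : M.E = Set.univ) {A : Set ι} {N F : Finset ι}
    {e : ι} (hN : IsMaximalMatroidMatching E M A N)
    (hF : ∀ f, f ∈ F ↔ f ∈ N ∧ ¬ Disjoint (E f) (E e))
    (hmin : ∀ J : Finset ι, IsMatroidMatching E M A J → M.closure ↑J = M.closure ↑N →
      F.card ≤ {f ∈ J | ¬ Disjoint (E f) (E e)}.card) :
    IsMaximalMatroidMatching E M (A ∩ {h | Disjoint (E h) (E e ∪ F.biUnion E)}) (N \ F) := by
  obtain ⟨⟨hNA, hNd, hNi⟩, hmax⟩ := hN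
  have hFN : F ⊆ N := fun f hf ↦ ((hF f).1 hf).1
  have havoid : ∀ h, Disjoint (E h) (E e ∪ F.biUnion E) ↔
      Disjoint (E h) (E e) ∧ ∀ f ∈ F, Disjoint (E h) (E f) := by
    intro h
    rw [Finset.disjoint_union_right, Finset.disjoint_biUnion_right]
  have hclosure : ∀ X : Finset ι, M.closure ↑X = M.closure ↑(N \ F) →
      M.closure ↑(X ∪ F) = M.closure ↑N := by
    intro X hX
    rw [Finset.coe_union, ← M.closure_union_closure_left_eq, hX,
      M.closure_union_closure_left_eq, ← Finset.coe_union, Finset.sdiff_union_of_subset hFN]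
  refine ⟨⟨fun f hf ↦ ?_, fun a ha b hb ↦ hNd a (Finset.sdiff_subset ha) b
    (Finset.sdiff_subset hb), hNi.subset (by simp)⟩, ?_⟩
  · obtain ⟨hfN, hfF⟩ := Finset.mem_sdiff.1 (Finset.mem_coe.1 hf)
    refine ⟨hNA hfN, (havoid f).2 ⟨?_, fun f' hf' ↦ hNd f hfN f' (hFN hf') ?_⟩⟩
    · by_contra hd
      exact hfF ((hF f).2 ⟨hfN, hd⟩)
    · rintro rfl
      exact hfF hf'
  intro X hX hXN g hg hgX
  by_contra! hgd
  have hXd : ∀ h ∈ insert g X, h ∈ A ∧ Disjoint (E h) (E e) ∧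
      ∀ f ∈ F, Disjoint (E h) (E f) := by
    intro h hh
    have : h ∈ A ∩ {h | Disjoint (E h) (E e ∪ F.biUnion E)} := by
      rcases Finset.mem_insert.1 hh with rfl | hh
      exacts [hg, hX.1 hh]
    exact ⟨this.1, (havoid h).1 this.2⟩
  have hgXd : ∀ a ∈ insert g X, ∀ b ∈ insert g X, a ≠ b → Disjoint (E a) (E b) := by
    intro a ha b hb hab
    obtain rfl | ha := Finset.mem_insert.1 ha <;> obtain rfl | hb := Finset.mem_insert.1 hb
    · exact absurd rfl hab
    · exact (hgd b hb).symm
    · exact hgd a ‹_›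
    · exact hX.2.1 a ha b hb hab
  have hYd : ∀ a ∈ insert g X ∪ F, ∀ b ∈ insert g X ∪ F, a ≠ b →
      Disjoint (E a) (E b) := by
    intro a ha b hb hab
    rcases Finset.mem_union.1 ha with ha | ha <;> rcases Finset.mem_union.1 hb with hb | hb
    · exact hgXd a ha b hb hab
    · exact (hXd a ha).2.2 b hb
    · exact ((hXd b hb).2.2 a ha).symm
    · exact hNd a (hFN ha) b (hFN hb) hab
  have hYA : ↑(insert g X ∪ F) ⊆ A := by
    intro a ha
    rcases Finset.mem_union.1 (Finset.mem_coe.1 ha) with ha | ha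
    exacts [(hXd a ha).1, hNA (hFN ha)]
  have hXY : X ∪ F ⊆ insert g X ∪ F :=
    Finset.union_subset_union_left (Finset.subset_insert g X)
  by_cases hgN : g ∈ M.closure ↑N
  · have hgi : IsMatroidMatching E M A (insert g X) := by
      refine ⟨fun a ha ↦ (hXd a ha).1, hgXd, ?_⟩
      rw [Finset.coe_insert]
      exact (hX.2.2.notMem_closure_iff (by simp [hM])).1 hgX |>.1
    obtain ⟨J, hXJ, hJY, hJ, hJcl⟩ := hgi.exists_extension hM
      (Finset.subset_union_left (s₂ := F)) hYA hYd
    have hJN : M.closure ↑J = M.closure ↑N := by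
      rw [hJcl, Finset.insert_union, Finset.coe_insert, ← hclosure X hXN]
      refine Matroid.closure_insert_eq_of_mem_closure ?_
      rwa [hclosure X hXN]
    refine (hmin J hJ hJN).not_gt (Finset.card_lt_card ⟨?_, fun hFJ ↦ ?_⟩)
    · intro f hf
      obtain ⟨hfJ, hfe⟩ := Finset.mem_filter.1 hf
      rcases Finset.mem_union.1 (hJY hfJ) with hf' | hf'
      exacts [absurd (hXd f hf').2.1 hfe, hf']
    · have hgF : g ∉ F := fun hgF ↦
        ((hF g).1 hgF).2 (hXd g (Finset.mem_insert_self g X)).2.1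
      have hgX' : g ∉ X := fun h ↦ hgX (M.mem_closure_of_mem' h (by simp [hM]))
      refine hJ.2.2.notMem_closure_sdiff_of_mem (hXJ (Finset.mem_insert_self g X)) ?_
      rw [← hclosure X hXN] at hgN
      refine M.closure_subset_closure ?_ hgN
      intro a ha
      rcases Finset.mem_union.1 (Finset.mem_coe.1 ha) with ha | ha
      · exact ⟨hXJ (Finset.mem_insert_of_mem ha), by rintro rfl; exact hgX' ha⟩
      · exact ⟨(Finset.mem_filter.1 (hFJ ha)).1, by rintro rfl; exact hgF ha⟩
  · obtain ⟨J, -, hJY, hJ, hJcl⟩ := hX.exists_extension hM (Finset.subset_union_left (s₂ := F))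
      ((Finset.coe_subset.2 hXY).trans hYA) fun a ha b hb ↦ hYd a (hXY ha) b (hXY hb)
    have hJN : M.closure ↑J = M.closure ↑N := hJcl.trans (hclosure X hXN)
    obtain ⟨f, hfJ, hfg⟩ := hmax J hJ hJN g hg.1 (by rwa [hJN])
    rcases Finset.mem_union.1 (hJY hfJ) with hf | hf
    · exact hfg (hgd f hf)
    · exact hfg ((hXd g (Finset.mem_insert_self g X)).2.2 f hf).symm

/-- A set `e` of size at most `r` together with `k ≥ 1` sets of size at most `r` meeting it
covers at most `(2r - 1)k` points. -/
theorem card_union_biUnion_le_of_meets {V ι : Type*} [DecidableEq V] {E : ι → Finset V}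
    {r : ℕ} (hsize : ∀ e, (E e).card ≤ r) {F : Finset ι} {e : ι} (hF : F.Nonempty)
    (hmeet : ∀ f ∈ F, ¬ Disjoint (E f) (E e)) :
    (E e ∪ F.biUnion E).card ≤ (2 * r - 1) * F.card := by
  have hsplit : E e ∪ F.biUnion E = E e ∪ F.biUnion fun f ↦ E f \ E e := by
    ext v
    simp only [Finset.mem_union, Finset.mem_biUnion, Finset.mem_sdiff]
    tauto
  have hpart : ∀ f ∈ F, (E f \ E e).card ≤ r - 1 := by
    intro f hf
    have hpos : 0 < (E f ∩ E e).card :=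
      Finset.card_pos.2 (Finset.not_disjoint_iff_nonempty_inter.1 (hmeet f hf))
    have := Finset.card_sdiff_add_card_inter (E f) (E e)
    have := hsize f
    omega
  obtain ⟨f, hf⟩ := hF
  have hr : 1 ≤ r := by
    obtain ⟨v, hv, -⟩ := Finset.not_disjoint_iff.1 (hmeet f hf)
    exact (Finset.card_pos.2 ⟨v, hv⟩).trans_le (hsize f)
  have hk : 1 ≤ F.card := Finset.card_pos.2 ⟨f, hf⟩
  calc (E e ∪ F.biUnion E).card
      ≤ (E e).card + (F.biUnion fun f ↦ E f \ E e).card := by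
        rw [hsplit]
        exact Finset.card_union_le _ _
    _ ≤ r + F.card * (r - 1) := add_le_add (hsize e) (Finset.card_biUnion_le_card_mul _ _ _ hpart)
    _ ≤ (2 * r - 1) * F.card := by
        obtain ⟨s, rfl⟩ := Nat.exists_eq_add_of_le hr
        have h1 : 2 * (1 + s) - 1 = 2 * s + 1 := by omega
        have h2 : 1 + s - 1 = s := by omega
        rw [h1, h2]
        nlinarith

theorem IsMaximalMatroidMatching.exists_spanning_after_deletion {V ι : Type*} [DecidableEq V]
    {E : ι → Finset V} {M : Matroid ι} (hM : M.E = Set.univ) {r : ℕ}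
    (hsize : ∀ e, (E e).card ≤ r) {A : Set ι} {N : Finset ι}
    (hN : IsMaximalMatroidMatching E M A N) :
    ∃ (a : ℕ) (U : Finset V), a ≤ N.card ∧ U.card ≤ (2 * r - 1) * a ∧
      ∃ N' : Finset ι, IsMatroidMatching E M (A ∩ {e | Disjoint (E e) U}) N' ∧
        N'.card = N.card - a ∧
        M.closure ↑N' = M.closure (A ∩ {e | Disjoint (E e) U}) := by
  classical
  induction hn : N.card using Nat.strong_induction_on generalizing A N with
  | _ n ih =>
  by_cases hspan : A ⊆ M.closure ↑N
  · refine ⟨0, ∅, by simp, by simp, N, by simpa using hN.1, by simpa using hn, ?_⟩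
    simpa using (M.closure_subset_closure hN.1.1).antisymm
      (M.closure_subset_closure_of_subset_closure hspan)
  obtain ⟨e₀, he₀A, he₀⟩ := Set.not_subset.1 hspan
  let S : Set (Finset ι × ι) := {p | IsMatroidMatching E M A p.1 ∧
    M.closure ↑p.1 = M.closure ↑N ∧ p.2 ∈ A ∧ p.2 ∉ M.closure ↑N}
  let meets : Finset ι × ι → ℕ := fun p ↦ {f ∈ p.1 | ¬ Disjoint (E f) (E p.2)}.card
  have hS : S.Nonempty := ⟨(N, e₀), hN.1, rfl, he₀A, he₀⟩
  obtain ⟨⟨N₁, e⟩, ⟨hN₁, hcl, heA, he⟩, hmin⟩ :=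
    exists_minimalFor_of_wellFoundedLT (· ∈ S) meets hS
  dsimp only at hN₁ hcl heA he
  have hmin' : ∀ p ∈ S, meets (N₁, e) ≤ meets p := fun p hp ↦
    (le_total (meets p) (meets (N₁, e))).elim (hmin hp) id
  have hcard : N₁.card = n := by
    have h := hN₁.2.2.isBasis_closure.encard_eq_encard (hcl ▸ hN.1.2.2.isBasis_closure)
    rw [Set.encard_coe_eq_coe_finsetCard, Set.encard_coe_eq_coe_finsetCard] at h
    exact_mod_cast (Nat.cast_inj.1 h).trans hn
  set F : Finset ι := {f ∈ N₁ | ¬ Disjoint (E f) (E e)} with hFdef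
  have hFN : F ⊆ N₁ := Finset.filter_subset _ _
  have hFne : F.Nonempty := by
    obtain ⟨f, hf, hfe⟩ := hN.2 N₁ hN₁ hcl e heA (by rwa [hcl])
    exact ⟨f, Finset.mem_filter.2 ⟨hf, hfe⟩⟩
  have hN₁max : IsMaximalMatroidMatching E M A N₁ :=
    ⟨hN₁, fun X hX hXN ↦ hN.2 X hX (hXN.trans hcl)⟩
  have hdel := hN₁max.delete hM (F := F) (e := e) (by simp [hFdef])
    fun J hJ hJN ↦ hmin' (J, e) ⟨hJ, hJN.trans hcl, heA, he⟩
  have hFcard : 0 < F.card := hFne.card_pos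
  have hFle := Finset.card_le_card hFN
  have hsd : (N₁ \ F).card = n - F.card := by rw [Finset.card_sdiff_of_subset hFN, hcard]
  obtain ⟨a, U, ha, hU, N', hN', hN'card, hN'cl⟩ := ih (n - F.card) (by omega) hdel hsd
  have hA : A ∩ {h | Disjoint (E h) (E e ∪ F.biUnion E)} ∩ {h | Disjoint (E h) U} =
      A ∩ {h | Disjoint (E h) ((E e ∪ F.biUnion E) ∪ U)} := by
    ext h
    simp only [Set.mem_inter_iff, Set.mem_ofPred_eq, Finset.disjoint_union_right (t := _ ∪ _)]
    tauto
  rw [hA] at hN' hN'cl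
  refine ⟨F.card + a, (E e ∪ F.biUnion E) ∪ U, by omega, ?_, N', hN', by omega, hN'cl⟩
  rw [mul_add]
  exact (Finset.card_union_le _ _).trans (add_le_add
    (card_union_biUnion_le_of_meets hsize hFne fun f hf ↦ (Finset.mem_filter.1 hf).2) hU)

/-- If a (multi-)hypergraph `H` with hyperedges of size at most `r ≥ 1`, labelled in a
matroid `M` by `γ`, contains a maximal independent matching of size `ℓ`, then there are
`0 ≤ a ≤ ℓ` and a vertex set `U` with `|U| ≤ (2r-1)a` such that `H - U` contains an
independent matching of size `ℓ - a` whose set of labels is a basis of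
`span (γ(E(H-U)))` (i.e. an independent set with the same span). -/
theorem exists_spanning_indep_matching_after_deletion {V ι α : Type*} [Fintype V]
    [DecidableEq V] [Fintype ι]
    (r : ℕ) (hr : 1 ≤ r)
    (E : ι → Finset V) (hE : ∀ e, (E e).Nonempty) (hsize : ∀ e, (E e).card ≤ r)
    (M : Matroid α) (γ : ι → α) (hγ : ∀ e, γ e ∈ M.E)
    (N : Finset ι) (ℓ : ℕ) (hN : IsMaximalIndepMatching E M γ Set.univ N)
    (hNcard : N.card = ℓ) :
    ∃ (a : ℕ) (U : Finset V), a ≤ ℓ ∧ U.card ≤ (2 * r - 1) * a ∧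
      ∃ N' : Finset ι, IsIndepMatching E M γ {e | Disjoint (E e) U} N' ∧
        N'.card = ℓ - a ∧
        M.closure (γ '' ↑N') = M.closure (γ '' {e | Disjoint (E e) U}) := by
  classical
  subst hNcard
  have hM : (M.comap γ).E = Set.univ := by
    ext e
    simp [hγ e]
  have hmax : IsMaximalMatroidMatching E (M.comap γ) Set.univ N := by
    refine ⟨isIndepMatching_iff_comap.1 hN.1, fun X hX hXN g _ hgX ↦ ?_⟩
    by_contra! hd
    have hg : g ∉ X := fun h ↦ hgX ((M.comap γ).mem_closure_of_mem' h (hγ g))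
    refine hN.2 X (isIndepMatching_iff_comap.2 hX)
      ((M.comap_closure_eq_closure_iff hγ _ _).1 hXN) (insert g X)
      (isIndepMatching_iff_comap.2 ⟨Set.subset_univ _, ?_, ?_⟩) (Finset.ssubset_insert hg)
    · intro a ha b hb hab
      rcases Finset.mem_insert.1 ha with rfl | ha <;> rcases Finset.mem_insert.1 hb with rfl | hb
      · exact absurd rfl hab
      · exact (hd b hb).symm
      · exact hd a ‹_›
      · exact hX.2.1 a ha b hb hab
    · rw [Finset.coe_insert]
      exact ((hX.2.2.notMem_closure_iff (hγ g)).1 hgX).1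
  obtain ⟨a, U, ha, hU, N', hN', hcard, hcl⟩ := hmax.exists_spanning_after_deletion hM hsize
  rw [Set.univ_inter] at hN' hcl
  exact ⟨a, U, ha, hU, N', isIndepMatching_iff_comap.2 hN', hcard,
    (M.comap_closure_eq_closure_iff hγ _ _).1 hcl⟩
end

section
/- Let p be a prime and let d′ ≤ d be positive integers. Then f(p,d′) ≤ f(p,d); that is, if m is a positive integer such that the multiset union of any m linear bases of (Z_p)^d over F_p is an additive basis of (Z_p)^d, then the multiset union of any m linear bases of (Z_p)^{d′} over F_p is an additive basis of (Z_p)^{d′}. -/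
/-- A multiset `B` of elements of `(ℤ_p)^d` is an *additive basis* if every element of
`(ℤ_p)^d` can be written as the sum of the elements of a (possibly empty) sub-multiset of `B`. -/
def IsAdditiveBasis (p d : ℕ) (B : Multiset (Fin d → ZMod p)) : Prop :=
  ∀ x : Fin d → ZMod p, ∃ S : Multiset (Fin d → ZMod p), S ≤ B ∧ S.sum = x

/-- The property that the multiset union of any `m` linear bases of `(ℤ_p)^d` over `F_p`
forms an additive basis of `(ℤ_p)^d`. -/
def AdditiveBasisProp (p d m : ℕ) : Prop :=
  ∀ b : Fin m → Fin d → (Fin d → ZMod p),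
    (∀ i, LinearIndependent (ZMod p) (b i)) →
    (∀ i, Submodule.span (ZMod p) (Set.range (b i)) = ⊤) →
    IsAdditiveBasis p d
      ((Finset.univ.val : Multiset (Fin m)).bind fun i =>
        Multiset.map (b i) (Finset.univ.val : Multiset (Fin d)))

/-- `f p d` is the smallest positive integer `m` such that the multiset union of any `m`
linear bases of `(ℤ_p)^d` is an additive basis of `(ℤ_p)^d`. -/
noncomputable def f (p d : ℕ) : ℕ := sInf {m | 0 < m ∧ AdditiveBasisProp p d m}

theorem Multiset.le_map_iff_exists {α β : Type*} {v : α → β} {s : Multiset α} {S : Multiset β} :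
    S ≤ s.map v ↔ ∃ t ≤ s, t.map v = S := by
  constructor
  · intro h
    have hS : S ∈ Multiset.powersetCard S.card (s.map v) := Multiset.mem_powersetCard.2 ⟨h, rfl⟩
    rw [Multiset.powersetCard_map, Multiset.mem_map] at hS
    obtain ⟨t, ht, rfl⟩ := hS
    exact ⟨t, (Multiset.mem_powersetCard.1 ht).1, rfl⟩
  · rintro ⟨t, ht, rfl⟩
    exact Multiset.map_le_map ht

/-- The union of an indexed collection of families is an additive basis exactly when every vector
is a sum over a finite set of indices. -/
theorem isAdditiveBasis_bind_iff {p d m : ℕ} (b : Fin m → Fin d → (Fin d → ZMod p)) :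
    IsAdditiveBasis p d ((Finset.univ.val : Multiset (Fin m)).bind fun i =>
        Multiset.map (b i) (Finset.univ.val : Multiset (Fin d))) ↔
      ∀ x, ∃ T : Finset (Fin m × Fin d), ∑ q ∈ T, b q.1 q.2 = x := by
  have hB : ((Finset.univ.val : Multiset (Fin m)).bind fun i =>
        Multiset.map (b i) (Finset.univ.val : Multiset (Fin d))) =
      (Finset.univ : Finset (Fin m × Fin d)).val.map fun q => b q.1 q.2 := by
    rw [← Finset.univ_product_univ, Finset.product_val]
    simp only [SProd.sprod, Multiset.product, Multiset.map_bind, Multiset.map_map]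
    rfl
  rw [hB]
  refine forall_congr' fun x => ?_
  constructor
  · rintro ⟨S, hS, rfl⟩
    obtain ⟨t, ht, rfl⟩ := Multiset.le_map_iff_exists.1 hS
    exact ⟨⟨t, Multiset.nodup_of_le ht Finset.univ.nodup⟩, rfl⟩
  · rintro ⟨T, rfl⟩
    exact ⟨T.val.map fun q => b q.1 q.2,
      Multiset.map_le_map (Finset.val_le_iff.2 T.subset_univ), rfl⟩

/-- Every family of `m` linear bases forms an additive basis as soon as `m` is so large that some
basis must be repeated `p` times. -/
theorem exists_additiveBasisProp (p d : ℕ) [Fact p.Prime] : ∃ m, 0 < m ∧ AdditiveBasisProp p d m := by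
  classical
  refine ⟨Fintype.card (Fin d → (Fin d → ZMod p)) * p,
    Nat.mul_pos Fintype.card_pos (Fact.out : p.Prime).pos, fun b hli hsp => ?_⟩
  rw [isAdditiveBasis_bind_iff]
  intro x
  obtain ⟨b₀, hb₀⟩ := Fintype.exists_le_card_fiber_of_mul_le_card (n := p) b (by simp)
  obtain ⟨i₀, hi₀⟩ := Finset.card_pos.1 ((Fact.out : p.Prime).pos.trans_le hb₀)
  obtain rfl : b i₀ = b₀ := by simpa using hi₀
  let B := Module.Basis.mk (hli i₀) (hsp i₀).ge
  choose A hA hAcard using fun j => Finset.exists_subset_card_eq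
    ((ZMod.val_lt (B.repr x j)).le.trans hb₀)
  refine ⟨Finset.univ.filter fun q => q.1 ∈ A q.2, ?_⟩
  rw [Finset.sum_filter, Fintype.sum_prod_type_right]
  conv_rhs => rw [← B.sum_repr x]
  refine Finset.sum_congr rfl fun j _ => ?_
  have hAb : ∀ i ∈ A j, b i j = b i₀ j := fun i hi => by
    have := hA j hi
    rw [Finset.mem_filter] at this
    rw [this.2]
  dsimp only
  rw [← Finset.sum_filter, Finset.filter_mem_eq_inter, Finset.univ_inter,
    Finset.sum_congr rfl hAb, Finset.sum_const, hAcard, ← Nat.cast_smul_eq_nsmul (ZMod p),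
    ZMod.natCast_zmod_val, Module.Basis.mk_apply]

/-- Bases of the first factor are completed by the standard basis of the second. -/
theorem AdditiveBasisProp.of_add {p d k m : ℕ} (h : AdditiveBasisProp p (d + k) m) :
    AdditiveBasisProp p d m := by
  classical
  intro b hli hsp
  rw [isAdditiveBasis_bind_iff]
  intro x
  let e : (Fin (d + k) → ZMod p) ≃ₗ[ZMod p] (Fin d → ZMod p) × (Fin k → ZMod p) :=
    (LinearEquiv.funCongrLeft (ZMod p) (ZMod p) finSumFinEquiv).trans
      (LinearEquiv.sumArrowLequivProdArrow (Fin d) (Fin k) (ZMod p) (ZMod p))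
  let B : Fin m → Module.Basis (Fin (d + k)) (ZMod p) (Fin (d + k) → ZMod p) := fun i =>
    (((Module.Basis.mk (hli i) (hsp i).ge).prod (Pi.basisFun (ZMod p) (Fin k))).map e.symm).reindex
      finSumFinEquiv
  have hB : ∀ i j, (e (B i j)).1 = Sum.elim (b i) 0 (finSumFinEquiv.symm j) := fun i j => by
    simp only [B, Module.Basis.reindex_apply, Module.Basis.map_apply, LinearEquiv.apply_symm_apply]
    cases finSumFinEquiv.symm j <;> simp
  obtain ⟨T, hT⟩ := (isAdditiveBasis_bind_iff _).1
    (h (fun i => B i) (fun i => (B i).linearIndependent) fun i => (B i).span_eq) (e.symm (x, 0))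
  refine ⟨Finset.univ.filter fun q => (q.1, Fin.castAdd k q.2) ∈ T, ?_⟩
  have hx := congrArg (fun y => (e y).1) hT
  simp only [map_sum, Prod.fst_sum, hB, LinearEquiv.apply_symm_apply] at hx
  rw [← hx, Finset.sum_filter, ← Finset.univ_inter T, ← Finset.filter_mem_eq_inter,
    Finset.sum_filter, Fintype.sum_prod_type, Fintype.sum_prod_type]
  refine Finset.sum_congr rfl fun i _ => ?_
  rw [Fin.sum_univ_add]
  simp

/-- For a prime `p` and positive integers `d' ≤ d`, `f(p,d') ≤ f(p,d)`. -/
theorem f_mono (p d d' : ℕ) (hp : p.Prime) (hd' : 0 < d') (hdd : d' ≤ d) :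
    f p d' ≤ f p d := by
  have : Fact p.Prime := ⟨hp⟩
  obtain ⟨k, rfl⟩ := Nat.exists_eq_add_of_le hdd
  obtain ⟨hpos, hf⟩ := Nat.sInf_mem (exists_additiveBasisProp p (d' + k))
  exact Nat.sInf_le ⟨hpos, hf.of_add⟩
end
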